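/- arXiv:2502.21200 — 10 statements merged into one kernel-verified Lean document; each statement's English description precedes it below -/
import Mathlib

section
/- Define A(u) = 2u² − u²·log(u²) for u > 0. For every r₀ ∈ (0, e) there exists a unique r₊ ∈ (√e, e) such that A(r₊) = (3/4)·A(r₀); moreover r₀ < r₊. -/
theorem two_mul_sub_mul_log_strictAntiOn :
    StrictAntiOn (fun t : ℝ => 2 * t - t * Real.log t) (Set.Ici (Real.exp 1)) := by
  intro s hs t ht hst
  have hs0 : 0 < s := (Real.exp_pos 1).trans_le hs
  have ht0 : 0 < t := hs0.trans hst
  have hlog : 1 ≤ Real.log s := (Real.le_log_iff_exp_le hs0).2 hs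
  have h := Real.log_lt_sub_one_of_pos (div_pos hs0 ht0) (div_lt_one ht0 |>.2 hst).ne
  rw [Real.log_div hs0.ne' ht0.ne'] at h
  have h' := mul_lt_mul_of_pos_left h ht0
  have htangent : t * (s / t - 1) = s - t := by field_simp
  rw [htangent] at h'
  change 2 * t - t * Real.log t < 2 * s - s * Real.log s
  nlinarith [mul_nonneg (sub_nonneg.2 hst.le) (sub_nonneg.2 hlog)]

theorem two_mul_sub_mul_log_le_exp_one {t : ℝ} (ht : 0 < t) :
    2 * t - t * Real.log t ≤ Real.exp 1 := by
  have h := Real.log_le_sub_one_of_pos (div_pos (Real.exp_pos 1) ht)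
  rw [Real.log_div (Real.exp_pos 1).ne' ht.ne', Real.log_exp] at h
  have h' := mul_le_mul_of_nonneg_left h ht.le
  have htangent : t * (Real.exp 1 / t - 1) = Real.exp 1 - t := by field_simp
  rw [htangent] at h'
  linarith

/-- For every `r₀ ∈ (0, e)` there is a unique `r₊ ∈ (√e, e)` with
`A r₊ = (3/4) A r₀`, where `A u = 2u² - u² log(u²)`; moreover `r₀ < r₊`. -/
theorem turning_point_exists_unique (A : ℝ → ℝ)
    (hA : ∀ u, A u = 2 * u ^ 2 - u ^ 2 * Real.log (u ^ 2)) :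
    ∀ r₀ ∈ Set.Ioo (0 : ℝ) (Real.exp 1),
      (∃! rp : ℝ, rp ∈ Set.Ioo (Real.sqrt (Real.exp 1)) (Real.exp 1) ∧
        A rp = 3 / 4 * A r₀) ∧
      ∀ rp : ℝ, rp ∈ Set.Ioo (Real.sqrt (Real.exp 1)) (Real.exp 1) →
        A rp = 3 / 4 * A r₀ → r₀ < rp := by
  rintro r₀ ⟨h0, he⟩
  have hsqrt : Real.sqrt (Real.exp 1) ≤ Real.exp 1 :=
    Real.sqrt_le_iff.2 ⟨(Real.exp_pos 1).le,
      le_self_pow₀ (Real.one_le_exp zero_le_one) two_ne_zero⟩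
  have hanti : StrictAntiOn A (Set.Ici (Real.sqrt (Real.exp 1))) := by
    intro s hs t ht hst
    rw [hA, hA]
    exact two_mul_sub_mul_log_strictAntiOn (Real.sqrt_le_iff.1 hs).2
      (Real.sqrt_le_iff.1 ht).2
      (pow_lt_pow_left₀ hst ((Real.sqrt_nonneg _).trans hs) two_ne_zero)
  have hpos : 0 < A r₀ := by
    have hlog : Real.log r₀ < 1 := (Real.log_lt_iff_lt_exp h0).2 he
    rw [hA, Real.log_pow]
    push_cast
    nlinarith [mul_pos (pow_pos h0 2) (sub_pos.2 hlog)]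
  have hle : A r₀ ≤ Real.exp 1 := by
    rw [hA]
    exact two_mul_sub_mul_log_le_exp_one (pow_pos h0 2)
  have hA_sqrt : A (Real.sqrt (Real.exp 1)) = Real.exp 1 := by
    rw [hA, Real.sq_sqrt (Real.exp_pos 1).le, Real.log_exp]
    ring
  have hA_exp : A (Real.exp 1) = 0 := by
    rw [hA, Real.log_pow, Real.log_exp]
    push_cast
    ring
  have hcont : Continuous A := by
    rw [funext hA]
    exact (continuous_const.mul (continuous_pow 2)).sub
      (Real.continuous_mul_log.comp (continuous_pow 2))
  obtain ⟨rp, hrp, hval⟩ := intermediate_value_Ioo' hsqrt hcont.continuousOn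
    (show 3 / 4 * A r₀ ∈ Set.Ioo (A (Real.exp 1)) (A (Real.sqrt (Real.exp 1))) by
      rw [hA_exp, hA_sqrt]
      constructor <;> linarith)
  refine ⟨⟨rp, ⟨hrp, hval⟩, fun y hy => ?_⟩, fun y hy hyval => ?_⟩
  · exact hanti.injOn hy.1.1.le hrp.1.le (hy.2.trans hval.symm)
  · by_contra! h
    have := hanti.antitoneOn hy.1.le (hy.1.le.trans h) h
    linarith
end

section
/- Define f(φ) = φ²·(3 − log(φ²)) − e·(1 + log(φ²)) for φ > 0. Then f is strictly decreasing on (0, ∞), f(√e) = 0, and consequently f(φ) > 0 for all φ ∈ (0, √e) and f(φ) < 0 for all φ ∈ (√e, ∞). -/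
open Set in
/-- `t (3 - log t) - e (1 + log t)` is strictly decreasing on `(0, ∞)`: its derivative
`2 - log t - e / t` is negative except at `t = e`. -/
theorem strictAntiOn_mul_three_sub_log_sub_exp_one_mul :
    StrictAntiOn (fun t : ℝ => t * (3 - Real.log t) - Real.exp 1 * (1 + Real.log t)) (Ioi 0) := by
  have hderiv : ∀ t : ℝ, 0 < t →
      HasDerivAt (fun t : ℝ => t * (3 - Real.log t) - Real.exp 1 * (1 + Real.log t))
        (2 - Real.log t - Real.exp 1 / t) t := by
    intro t ht
    have hlog := Real.hasDerivAt_log ht.ne'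
    refine (((hasDerivAt_id' t).mul (hlog.const_sub 3)).sub
      ((hlog.const_add 1).const_mul (Real.exp 1))).congr_deriv ?_
    field_simp
    ring
  have hneg : ∀ t : ℝ, 0 < t → t ≠ Real.exp 1 → 2 - Real.log t - Real.exp 1 / t < 0 := by
    intro t ht hte
    have he := Real.exp_pos 1
    have h := Real.log_lt_sub_one_of_pos (div_pos he ht)
      (fun h => hte ((div_eq_one_iff_eq ht.ne').1 h).symm)
    rw [Real.log_div he.ne' ht.ne', Real.log_exp] at h
    linarith
  have hcont : ContinuousOn
      (fun t : ℝ => t * (3 - Real.log t) - Real.exp 1 * (1 + Real.log t)) (Ioi 0) :=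
    fun t ht => (hderiv t ht).continuousAt.continuousWithinAt
  have he := Real.exp_pos 1
  rw [← Ioc_union_Ici_eq_Ioi he]
  refine StrictAntiOn.union (c := Real.exp 1) ?_ ?_ (isGreatest_Ioc he) isLeast_Ici
  · refine strictAntiOn_of_deriv_neg (convex_Ioc _ _) (hcont.mono Ioc_subset_Ioi_self) ?_
    intro t ht
    rw [interior_Ioc] at ht
    rw [(hderiv t ht.1).deriv]
    exact hneg t ht.1 ht.2.ne
  · refine strictAntiOn_of_deriv_neg (convex_Ici _) (hcont.mono (Ici_subset_Ioi.2 he)) ?_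
    intro t ht
    rw [interior_Ici] at ht
    rw [(hderiv t (he.trans ht)).deriv]
    exact hneg t (he.trans ht) (ne_of_gt ht)

/-- `f φ = φ²(3 - log φ²) - e(1 + log φ²)` is strictly decreasing on `(0, ∞)`,
vanishes at `√e`, is positive on `(0, √e)` and negative on `(√e, ∞)`. -/
theorem numerator_f_sign (f : ℝ → ℝ)
    (hf : ∀ φ : ℝ, f φ =
      φ ^ 2 * (3 - Real.log (φ ^ 2)) - Real.exp 1 * (1 + Real.log (φ ^ 2))) :
    StrictAntiOn f (Set.Ioi 0) ∧
    f (Real.sqrt (Real.exp 1)) = 0 ∧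
    (∀ φ ∈ Set.Ioo 0 (Real.sqrt (Real.exp 1)), 0 < f φ) ∧
    ∀ φ ∈ Set.Ioi (Real.sqrt (Real.exp 1)), f φ < 0 := by
  have hanti : StrictAntiOn f (Set.Ioi 0) := by
    intro a ha b hb hab
    rw [hf, hf]
    exact strictAntiOn_mul_three_sub_log_sub_exp_one_mul
      (Set.mem_Ioi.2 (pow_pos ha 2)) (Set.mem_Ioi.2 (pow_pos hb 2))
      (pow_lt_pow_left₀ hab (le_of_lt ha) two_ne_zero)
  have hzero : f (Real.sqrt (Real.exp 1)) = 0 := by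
    rw [hf, Real.sq_sqrt (Real.exp_pos 1).le, Real.log_exp]
    ring
  have hpos : 0 < Real.sqrt (Real.exp 1) := Real.sqrt_pos.2 (Real.exp_pos 1)
  refine ⟨hanti, hzero, fun φ hφ => ?_, fun φ hφ => ?_⟩
  · exact hzero ▸ hanti hφ.1 hpos hφ.2
  · exact hzero ▸ hanti hpos (hpos.trans hφ) hφ
end

section
/- For every φ ∈ (√e, e) one has [φ²·(3 − log(φ²)) − e·(1 + log(φ²))] / [φ²·(1 − log(φ²))²] > (1 − log(φ²)) / φ². -/
/-- Third-order Taylor lower bound for the exponential on the nonnegative reals. -/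
theorem Real.cubic_le_exp_of_nonneg {t : ℝ} (ht : 0 ≤ t) :
    1 + t + t ^ 2 / 2 + t ^ 3 / 6 ≤ Real.exp t := by
  have h := Real.sum_le_exp_of_nonneg ht 4
  norm_num [Finset.sum_range_succ, Nat.factorial] at h
  linarith

/-- For `φ ∈ (√e, e)` one has
`(φ²(3 - log φ²) - e(1 + log φ²)) / (φ²(1 - log φ²)²) > (1 - log φ²)/φ²`. -/
theorem integrand_lower_bound :
    ∀ φ ∈ Set.Ioo (Real.sqrt (Real.exp 1)) (Real.exp 1),
      (φ ^ 2 * (3 - Real.log (φ ^ 2)) - Real.exp 1 * (1 + Real.log (φ ^ 2))) /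
          (φ ^ 2 * (1 - Real.log (φ ^ 2)) ^ 2) >
        (1 - Real.log (φ ^ 2)) / φ ^ 2 := by
  rintro φ ⟨h_lower, h_upper⟩
  have hφ : 0 < φ := (Real.sqrt_nonneg _).trans_lt h_lower
  have hφ2 : 0 < φ ^ 2 := by positivity
  have h_log_lower : 1 < Real.log (φ ^ 2) :=
    (Real.lt_log_iff_exp_lt hφ2).2 ((Real.sqrt_lt' hφ).1 h_lower)
  have h_log_upper : Real.log (φ ^ 2) < 2 := by
    have := (Real.log_lt_iff_lt_exp hφ).2 h_upper
    rw [Real.log_pow]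
    push_cast
    linarith
  obtain ⟨t, ht⟩ : ∃ t, Real.log (φ ^ 2) = 1 + t := ⟨Real.log (φ ^ 2) - 1, by ring⟩
  have h_exp : φ ^ 2 = Real.exp 1 * Real.exp t := by
    rw [← Real.exp_add, ← ht, Real.exp_log hφ2]
  rw [ht] at h_log_lower h_log_upper ⊢
  have ht0 : 0 < t := by linarith
  have h_taylor : -(t ^ 3 * (1 + t) / 6) ≤ Real.exp t * (2 - t) - (2 + t) := by
    nlinarith [mul_le_mul_of_nonneg_right (Real.cubic_le_exp_of_nonneg ht0.le)
      (by linarith : 0 ≤ 2 - t)]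
  have h_e : Real.exp 1 * (1 + t) < 6 := by
    nlinarith [Real.exp_one_lt_d9, Real.exp_pos 1]
  have h_cubic : -t ^ 3 < φ ^ 2 * (2 - t) - Real.exp 1 * (2 + t) := by
    rw [h_exp]
    nlinarith [mul_le_mul_of_nonneg_left h_taylor (Real.exp_pos 1).le,
      mul_lt_mul_of_pos_left h_e (pow_pos ht0 3)]
  have h_den : 0 < (1 - (1 + t)) ^ 2 := by
    rw [sub_add_cancel_left, neg_sq]
    positivity
  rw [gt_iff_lt, ← mul_div_mul_right _ (φ ^ 2) h_den.ne']
  gcongr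
  linear_combination h_cubic
end

section
/- Define A(u) = 2u² − u²·log(u²) for u > 0, so A'(u) = 2u(1 − log(u²)) and A''(u) = −2 − 2·log(u²). For r₀ ∈ (√e, e) let r₊ ∈ (√e, e) be the unique point with A(r₊) = (3/4)·A(r₀), set E₀ = −(3/4)·A(r₀), s₀ = √(A(r₀))/2, and T(r₀) = ∫_{r₀}^{r₊} (A(φ) + E₀)^{−1/2} dφ. Then (E₀ + e)·T(r₀) = ∫_{r₀}^{r₊} [3 − 2·(A(φ) − e)·A''(φ)/A'(φ)²]·√(A(φ) + E₀) dφ + 2·(A(r₀) − e)·s₀/A'(r₀). -/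
open intervalIntegral

open Set MeasureTheory in
/-- If `A` has derivative `A' < 0` and `A'` has derivative `A''` on `[a, b]`, then integrating the
derivative of `2 (A - c) √(A - A b) / A'` rewrites the period integral `∫ 1 / √(A - A b)`. -/
theorem regularized_integral_inv_sqrt {A A' A'' : ℝ → ℝ} {a b : ℝ} (hab : a ≤ b) (c : ℝ)
    (hA : ∀ u ∈ Icc a b, HasDerivAt A (A' u) u)
    (hA' : ∀ u ∈ Icc a b, HasDerivAt A' (A'' u) u)
    (hA'' : ContinuousOn A'' (Icc a b)) (hneg : ∀ u ∈ Icc a b, A' u < 0) :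
    (c - A b) * ∫ u in a..b, (√(A u - A b))⁻¹ =
      (∫ u in a..b, (3 - 2 * (A u - c) * A'' u / (A' u) ^ 2) * √(A u - A b)) +
        2 * (A a - c) * √(A a - A b) / A' a := by
  have hcA : ContinuousOn A (Icc a b) := HasDerivAt.continuousOn hA
  have hcA' : ContinuousOn A' (Icc a b) := HasDerivAt.continuousOn hA'
  have hne : ∀ u ∈ Icc a b, A' u ≠ 0 := fun u hu => (hneg u hu).ne
  have hanti : StrictAntiOn A (Icc a b) := by
    refine strictAntiOn_of_deriv_neg (convex_Icc a b) hcA fun u hu => ?_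
    have hu := interior_subset hu
    rw [(hA u hu).deriv]
    exact hneg u hu
  have hpos : ∀ u ∈ Ioo a b, 0 < A u - A b := fun u hu =>
    sub_pos.2 (hanti (Ioo_subset_Icc_self hu) (right_mem_Icc.2 hab) hu.2)
  have hcS : ContinuousOn (fun u => √(A u - A b)) (Icc a b) :=
    (hcA.sub continuousOn_const).sqrt
  have hdS : ∀ u ∈ Ioo a b,
      HasDerivAt (fun u => √(A u - A b)) (A' u / (2 * √(A u - A b))) u := fun u hu =>
    ((hA u (Ioo_subset_Icc_self hu)).sub_const _).sqrt (hpos u hu).ne'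
  have hint : IntervalIntegrable (fun u => (√(A u - A b))⁻¹) volume a b := by
    have h1 : IntervalIntegrable (fun u => -(A' u / (2 * √(A u - A b)))) volume a b := by
      refine intervalIntegral.intervalIntegrable_deriv_of_nonneg
        (g := fun u => -√(A u - A b)) ?_ ?_ ?_
      · rw [uIcc_of_le hab]
        exact hcS.neg
      · rw [min_eq_left hab, max_eq_right hab]
        exact fun u hu => (hdS u hu).neg
      · rw [min_eq_left hab, max_eq_right hab]
        intro u hu
        exact neg_nonneg.2 (div_nonpos_of_nonpos_of_nonneg
          (hneg u (Ioo_subset_Icc_self hu)).le (by positivity))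
    have h2 : ContinuousOn (fun u => -2 / A' u) (uIcc a b) := by
      rw [uIcc_of_le hab]
      exact continuousOn_const.div hcA' hne
    refine (h1.mul_continuousOn h2).congr fun u hu => ?_
    rw [uIoc_of_le hab] at hu
    have := hne u (Ioc_subset_Icc_self hu)
    by_cases h0 : √(A u - A b) = 0
    · simp [h0]
    · field_simp
  have hcR : ContinuousOn
      (fun u => (3 - 2 * (A u - c) * A'' u / (A' u) ^ 2) * √(A u - A b)) (Icc a b) := by
    refine (continuousOn_const.sub (ContinuousOn.div ?_ (hcA'.pow 2)
      fun u hu => pow_ne_zero 2 (hne u hu))).mul hcS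
    exact (continuousOn_const.mul (hcA.sub continuousOn_const)).mul hA''
  have hRint : IntervalIntegrable
      (fun u => (3 - 2 * (A u - c) * A'' u / (A' u) ^ 2) * √(A u - A b)) volume a b :=
    hcR.intervalIntegrable_of_Icc hab
  have key := intervalIntegral.integral_eq_sub_of_hasDerivAt_of_le
    (f := fun u => 2 * (A u - c) * √(A u - A b) / A' u)
    (f' := fun u => (3 - 2 * (A u - c) * A'' u / (A' u) ^ 2) * √(A u - A b) -
      (c - A b) * (√(A u - A b))⁻¹) hab
    (((continuousOn_const.mul (hcA.sub continuousOn_const)).mul hcS).div hcA' hne)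
    (fun u hu => ?_) (hRint.sub (hint.const_mul _))
  · rw [intervalIntegral.integral_sub hRint (hint.const_mul _),
      intervalIntegral.integral_const_mul] at key
    simp only [sub_self, Real.sqrt_zero, mul_zero, zero_div, zero_sub] at key
    linarith
  · have hu' := Ioo_subset_Icc_self hu
    have h0 := hne u hu'
    have hs : √(A u - A b) ≠ 0 := (Real.sqrt_pos.2 (hpos u hu)).ne'
    have hsq := Real.sq_sqrt (hpos u hu).le
    refine (((((hA u hu').sub_const c).const_mul 2).mul (hdS u hu)).div
      (hA' u hu') h0).congr_deriv ?_
    have hAu : A u = √(A u - A b) ^ 2 + A b := by linarith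
    simp only [Pi.mul_apply]
    generalize √(A u - A b) = s at *
    field_simp
    rw [hAu]
    ring

/-- The regularized integral representation of the period function: with
`A u = 2u² - u² log u²`, `A' u = 2u(1 - log u²)`, `A'' u = -2 - 2 log u²`,
`r₀ ∈ (√e, e)`, `r₊ ∈ (√e, e)` with `A r₊ = (3/4) A r₀`, `E₀ = -(3/4) A r₀`,
`s₀ = √(A r₀)/2` and `T = ∫_{r₀}^{r₊} (A φ + E₀)^{-1/2} dφ`, one has
`(E₀ + e) T = ∫_{r₀}^{r₊} [3 - 2(A φ - e) A'' φ / (A' φ)²] √(A φ + E₀) dφ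
  + 2 (A r₀ - e) s₀ / A' r₀`. -/
theorem period_regularized_representation (A A' A'' : ℝ → ℝ)
    (hA : ∀ u, A u = 2 * u ^ 2 - u ^ 2 * Real.log (u ^ 2))
    (hA' : ∀ u, A' u = 2 * u * (1 - Real.log (u ^ 2)))
    (hA'' : ∀ u, A'' u = -2 - 2 * Real.log (u ^ 2))
    (r₀ rp : ℝ)
    (hr₀ : r₀ ∈ Set.Ioo (Real.sqrt (Real.exp 1)) (Real.exp 1))
    (hrp : rp ∈ Set.Ioo (Real.sqrt (Real.exp 1)) (Real.exp 1))
    (hArp : A rp = 3 / 4 * A r₀)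
    (E₀ s₀ T : ℝ)
    (hE₀ : E₀ = -(3 / 4) * A r₀)
    (hs₀ : s₀ = Real.sqrt (A r₀) / 2)
    (hT : T = ∫ φ in r₀..rp, (Real.sqrt (A φ + E₀))⁻¹) :
    (E₀ + Real.exp 1) * T =
      (∫ φ in r₀..rp,
          (3 - 2 * (A φ - Real.exp 1) * A'' φ / (A' φ) ^ 2) * Real.sqrt (A φ + E₀)) +
        2 * (A r₀ - Real.exp 1) * s₀ / A' r₀ := by
  have hlog : ∀ u, Real.sqrt (Real.exp 1) < u → 1 < Real.log (u ^ 2) := fun u hu => by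
    have h := Real.sqrt_pos.2 (Real.exp_pos 1)
    rw [Real.lt_log_iff_exp_lt (pow_pos (h.trans hu) 2)]
    exact (Real.sqrt_lt' (h.trans hu)).1 hu
  have hpos : ∀ u, Real.sqrt (Real.exp 1) < u → 0 < u := fun u hu =>
    (Real.sqrt_nonneg _).trans_lt hu
  have hdlog : ∀ u : ℝ, 0 < u → HasDerivAt (fun u => Real.log (u ^ 2)) (2 * u / u ^ 2) u :=
    fun u hu => by simpa using (hasDerivAt_pow 2 u).log (pow_pos hu 2).ne'
  have hdA : ∀ u, 0 < u → HasDerivAt A (A' u) u := fun u hu => by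
    rw [funext hA, hA']
    have h2 : HasDerivAt (fun u : ℝ => u ^ 2) (2 * u) u := by simpa using hasDerivAt_pow 2 u
    refine ((h2.const_mul 2).sub (h2.mul (hdlog u hu))).congr_deriv ?_
    field_simp
    ring
  have hdA' : ∀ u, 0 < u → HasDerivAt A' (A'' u) u := fun u hu => by
    rw [funext hA', hA'']
    refine (((hasDerivAt_id' u).const_mul 2).mul ((hdlog u hu).const_sub 1)).congr_deriv ?_
    field_simp
    ring
  have hneg : ∀ u, Real.sqrt (Real.exp 1) < u → A' u < 0 := fun u hu => by
    rw [hA']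
    exact mul_neg_of_pos_of_neg (by linarith [hpos u hu]) (by linarith [hlog u hu])
  have hAr₀ : 0 < A r₀ := by
    have h : Real.log (r₀ ^ 2) < 2 := by
      have := (Real.log_lt_iff_lt_exp (hpos r₀ hr₀.1)).2 hr₀.2
      rw [Real.log_pow]
      push_cast
      linarith
    rw [hA]
    nlinarith [pow_pos (hpos r₀ hr₀.1) 2]
  have hanti : StrictAntiOn A (Set.Ioi (Real.sqrt (Real.exp 1))) := by
    refine strictAntiOn_of_deriv_neg (convex_Ioi _)
      (HasDerivAt.continuousOn fun u hu => hdA u (hpos u hu)) fun u hu => ?_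
    have hu := interior_subset hu
    rw [(hdA u (hpos u hu)).deriv]
    exact hneg u hu
  have hlt : r₀ < rp := (hanti.lt_iff_gt hrp.1 hr₀.1).1 (by linarith)
  have hgt : ∀ u ∈ Set.Icc r₀ rp, Real.sqrt (Real.exp 1) < u := fun u hu => hr₀.1.trans_le hu.1
  have hcA'' : ContinuousOn A'' (Set.Icc r₀ rp) := by
    rw [funext hA'']
    exact continuousOn_const.sub (continuousOn_const.mul
      (HasDerivAt.continuousOn fun u hu => hdlog u (hpos u (hgt u hu))))
  have key := regularized_integral_inv_sqrt hlt.le (Real.exp 1)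
    (fun u hu => hdA u (hpos u (hgt u hu))) (fun u hu => hdA' u (hpos u (hgt u hu))) hcA''
    (fun u hu => hneg u (hgt u hu))
  have hE : E₀ = -A rp := by rw [hE₀, hArp]; ring
  have hs : s₀ = Real.sqrt (A r₀ - A rp) := by
    rw [hs₀, hArp, show A r₀ - 3 / 4 * A r₀ = A r₀ / 2 ^ 2 by ring, Real.sqrt_div hAr₀.le,
      Real.sqrt_sq (by norm_num)]
  rw [hT, hs, hE]
  simp only [← sub_eq_add_neg]
  rw [neg_add_eq_sub]
  exact key
end

section
/- Define A(u) = 2u² − u²·log(u²) for u > 0, for r₀ ∈ (0, e) let r₊(r₀) be the unique point of (√e, e) with A(r₊(r₀)) = (3/4)·A(r₀), and let T(r₀) = ∫_{r₀}^{r₊(r₀)} (A(φ) − (3/4)·A(r₀))^{−1/2} dφ. Then T is strictly decreasing on (0, e): for all r₀, r₁ with 0 < r₀ < r₁ < e one has T(r₁) < T(r₀). -/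
open MeasureTheory Set

/-- The coefficient appearing in the energy identity after the substitution `φ = r₀ * exp s`. -/
noncomputable def energyCoeff (s : ℝ) : ℝ := 2 - 3 / 2 * Real.exp (-2 * s)

/-- The squared reciprocal of the period integrand, in the variable `τ = log (φ / r₀) / σ`, where
`σ` is the logarithm of the ratio of the endpoints. -/
noncomputable def scaledEnergy (σ τ : ℝ) : ℝ :=
  2 * (energyCoeff (σ * τ) - τ * energyCoeff σ) / (σ * energyCoeff σ)

lemma hasDerivAt_energyCoeff (s : ℝ) :
    HasDerivAt energyCoeff (3 * Real.exp (-2 * s)) s := by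
  have h : HasDerivAt (fun s : ℝ => -2 * s) (-2) s := by
    simpa using (hasDerivAt_id s).const_mul (-2)
  convert! (h.exp.const_mul (3 / 2)).const_sub 2 using 1
  ring

lemma continuous_energyCoeff : Continuous energyCoeff := by
  unfold energyCoeff
  fun_prop

lemma energyCoeff_strictMono : StrictMono energyCoeff := by
  intro x y hxy
  have := Real.exp_lt_exp.2 (by linarith : -2 * y < -2 * x)
  simp only [energyCoeff]
  linarith

lemma energyCoeff_pos {s : ℝ} (hs : 0 ≤ s) : 0 < energyCoeff s := by
  have h := energyCoeff_strictMono.monotone hs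
  have h0 : energyCoeff 0 = 1 / 2 := by norm_num [energyCoeff]
  linarith

lemma half_one_sub_le_energyCoeff_sub {σ τ : ℝ} (h0 : 0 ≤ τ) (h1 : τ ≤ 1) :
    (1 - τ) / 2 ≤ energyCoeff (σ * τ) - τ * energyCoeff σ := by
  have h := convexOn_exp.2 (mem_univ (-2 * σ)) (mem_univ 0) h0 (sub_nonneg.2 h1) (by ring)
  simp only [smul_eq_mul, mul_zero, add_zero, Real.exp_zero, mul_one] at h
  rw [show τ * (-2 * σ) = -2 * (σ * τ) by ring] at h
  simp only [energyCoeff]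
  linarith

lemma quadratic_lt_two_mul_exp {s : ℝ} (hs : 0 < s) :
    6 * s ^ 2 + 3 * s + 3 / 2 < 2 * Real.exp (2 * s) := by
  have h := Real.sum_le_exp_of_nonneg (by positivity : 0 ≤ 2 * s) 4
  norm_num [Finset.sum_range_succ, Nat.factorial] at h
  nlinarith [mul_nonneg hs.le (sq_nonneg (s - 2 / 5)), sq_nonneg (s - 1 / 2)]

lemma hasDerivAt_energyCoeff_div {s : ℝ} (hs : s ≠ 0) :
    HasDerivAt (fun s => energyCoeff s / s)
      ((3 * Real.exp (-2 * s) - energyCoeff s / s) / s) s := by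
  convert! (hasDerivAt_energyCoeff s).div (hasDerivAt_id s) hs using 1
  simp only [id]
  field_simp

lemma strictMonoOn_mul_deriv_energyCoeff_div :
    StrictMonoOn (fun s => 3 * Real.exp (-2 * s) - energyCoeff s / s) (Ioi 0) := by
  have hd : ∀ s ∈ Ioi (0 : ℝ), HasDerivAt (fun s => 3 * Real.exp (-2 * s) - energyCoeff s / s)
      (3 * (Real.exp (-2 * s) * -2) - (3 * Real.exp (-2 * s) - energyCoeff s / s) / s) s := by
    intro s hs
    have h : HasDerivAt (fun s : ℝ => -2 * s) (-2) s := by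
      simpa using (hasDerivAt_id s).const_mul (-2)
    exact (h.exp.const_mul 3).sub (hasDerivAt_energyCoeff_div (ne_of_gt hs))
  refine strictMonoOn_of_deriv_pos (convex_Ioi 0)
    (fun s hs => (hd s hs).continuousAt.continuousWithinAt) fun s hs => ?_
  rw [interior_Ioi] at hs
  rw [(hd s hs).deriv]
  have hs : 0 < s := hs
  have key := mul_lt_mul_of_pos_right (quadratic_lt_two_mul_exp hs) (Real.exp_pos (-2 * s))
  rw [mul_assoc 2 (Real.exp _), ← Real.exp_add] at key
  norm_num at key
  have : 3 * (Real.exp (-2 * s) * -2) - (3 * Real.exp (-2 * s) - energyCoeff s / s) / s =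
      (2 - (6 * s ^ 2 + 3 * s + 3 / 2) * Real.exp (-2 * s)) / s ^ 2 := by
    simp only [energyCoeff]
    field_simp
    ring
  rw [this]
  apply div_pos _ (by positivity)
  norm_num
  linarith

lemma strictAntiOn_energyCoeff_div_sub {τ : ℝ} (h0 : 0 < τ) (h1 : τ < 1) :
    StrictAntiOn (fun σ => energyCoeff (σ * τ) / (σ * τ) - energyCoeff σ / σ) (Ioi 0) := by
  have hd : ∀ σ ∈ Ioi (0 : ℝ),
      HasDerivAt (fun σ => energyCoeff (σ * τ) / (σ * τ) - energyCoeff σ / σ)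
      ((3 * Real.exp (-2 * (σ * τ)) - energyCoeff (σ * τ) / (σ * τ)) / (σ * τ) * τ -
        (3 * Real.exp (-2 * σ) - energyCoeff σ / σ) / σ) σ := by
    intro σ hσ
    have hσ : 0 < σ := hσ
    have h : HasDerivAt (fun σ : ℝ => σ * τ) τ σ := by
      simpa using (hasDerivAt_id σ).mul_const τ
    exact ((hasDerivAt_energyCoeff_div (mul_pos hσ h0).ne').comp σ h).sub
      (hasDerivAt_energyCoeff_div hσ.ne')
  refine strictAntiOn_of_deriv_neg (convex_Ioi 0)
    (fun s hs => (hd s hs).continuousAt.continuousWithinAt) fun σ hσ => ?_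
  rw [interior_Ioi] at hσ
  rw [(hd σ hσ).deriv]
  have hσ : 0 < σ := hσ
  have key := strictMonoOn_mul_deriv_energyCoeff_div (mem_Ioi.2 (mul_pos hσ h0)) (mem_Ioi.2 hσ)
    (by nlinarith : σ * τ < σ)
  simp only at key
  rw [div_mul_eq_mul_div, mul_div_mul_right _ _ h0.ne', ← sub_div]
  exact div_neg_of_neg_of_pos (sub_neg.2 key) hσ

lemma one_sub_div_le_scaledEnergy {σ τ : ℝ} (hσ : 0 < σ) (h0 : 0 ≤ τ) (h1 : τ ≤ 1) :
    (1 - τ) / (σ * energyCoeff σ) ≤ scaledEnergy σ τ := by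
  have := half_one_sub_le_energyCoeff_sub (σ := σ) h0 h1
  have hk := energyCoeff_pos hσ.le
  unfold scaledEnergy
  gcongr
  linarith

lemma scaledEnergy_pos {σ τ : ℝ} (hσ : 0 < σ) (h0 : 0 ≤ τ) (h1 : τ < 1) :
    0 < scaledEnergy σ τ :=
  (div_pos (sub_pos.2 h1) (mul_pos hσ (energyCoeff_pos hσ.le))).trans_le
    (one_sub_div_le_scaledEnergy hσ h0 h1.le)

lemma scaledEnergy_lt {σ₁ σ₂ τ : ℝ} (hσ₁ : 0 < σ₁) (h : σ₁ < σ₂) (h0 : 0 < τ) (h1 : τ < 1) :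
    scaledEnergy σ₂ τ < scaledEnergy σ₁ τ := by
  have hσ₂ := hσ₁.trans h
  have key := strictAntiOn_energyCoeff_div_sub h0 h1 (mem_Ioi.2 hσ₁) (mem_Ioi.2 hσ₂) h
  have hk := energyCoeff_strictMono h
  have hk₁ := energyCoeff_pos hσ₁.le
  have hk₂ := energyCoeff_pos hσ₂.le
  have eq : ∀ σ, 0 < σ → 0 < energyCoeff σ → scaledEnergy σ τ =
      2 * τ * (energyCoeff (σ * τ) / (σ * τ) - energyCoeff σ / σ) / energyCoeff σ := by
    intro σ hσ hk
    unfold scaledEnergy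
    field_simp
  have hpos := scaledEnergy_pos hσ₂ h0.le h1
  rw [eq _ hσ₂ hk₂] at hpos ⊢
  rw [eq _ hσ₁ hk₁]
  have hnum := (div_pos_iff_of_pos_right hk₂).1 hpos
  simp only at key
  have hnum' : 2 * τ * (energyCoeff (σ₂ * τ) / (σ₂ * τ) - energyCoeff σ₂ / σ₂) <
      2 * τ * (energyCoeff (σ₁ * τ) / (σ₁ * τ) - energyCoeff σ₁ / σ₁) := by
    gcongr
  exact div_lt_div₀ hnum' hk.le (hnum.trans hnum').le hk₁

lemma intervalIntegrable_inv_sqrt_scaledEnergy {σ : ℝ} (hσ : 0 < σ) :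
    IntervalIntegrable (fun τ => (Real.sqrt (scaledEnergy σ τ))⁻¹) volume 0 1 := by
  have hk := mul_pos hσ (energyCoeff_pos hσ.le)
  have h : IntervalIntegrable (fun τ : ℝ => (1 - τ) ^ (-(1 / 2) : ℝ)) volume 0 1 := by
    have := (intervalIntegral.intervalIntegrable_rpow' (a := 0) (b := 1)
      (by norm_num : (-1 : ℝ) < -(1 / 2))).comp_sub_left 1
    simpa using this.symm
  refine (h.const_mul (Real.sqrt (σ * energyCoeff σ))).mono_fun' ?_ ?_
  · refine Measurable.aestronglyMeasurable ?_
    have : Measurable (scaledEnergy σ) := by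
      have := continuous_energyCoeff
      exact Continuous.measurable (by unfold scaledEnergy; fun_prop)
    exact this.sqrt.inv
  · rw [uIoc_of_le zero_le_one, ← restrict_Ioo_eq_restrict_Ioc]
    refine (ae_restrict_mem measurableSet_Ioo).mono fun τ hτ => ?_
    have h1 : 0 < 1 - τ := sub_pos.2 hτ.2
    beta_reduce
    rw [Real.norm_of_nonneg (by positivity), Real.rpow_neg h1.le, ← Real.sqrt_eq_rpow,
      ← div_eq_mul_inv, ← Real.sqrt_div hk.le, ← Real.sqrt_inv]
    apply Real.sqrt_le_sqrt
    rw [← inv_div (1 - τ)]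
    exact inv_anti₀ (div_pos h1 hk) (one_sub_div_le_scaledEnergy hσ hτ.1.le hτ.2.le)

lemma integral_inv_sqrt_scaledEnergy_strictMonoOn :
    StrictMonoOn (fun σ => ∫ τ in (0 : ℝ)..1, (Real.sqrt (scaledEnergy σ τ))⁻¹) (Ioi 0) := by
  intro σ₁ hσ₁ σ₂ hσ₂ h
  have hi₁ := intervalIntegrable_inv_sqrt_scaledEnergy hσ₁
  have hi₂ := intervalIntegrable_inv_sqrt_scaledEnergy hσ₂
  simp only
  rw [← sub_pos, ← intervalIntegral.integral_sub hi₂ hi₁]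
  refine intervalIntegral.intervalIntegral_pos_of_pos_on (hi₂.sub hi₁) (fun τ hτ => ?_) one_pos
  have hpos := scaledEnergy_pos hσ₂ hτ.1.le hτ.2
  exact sub_pos.2 (inv_strictAnti₀ (Real.sqrt_pos.2 hpos)
    (Real.sqrt_lt_sqrt hpos.le (scaledEnergy_lt hσ₁ h hτ.1 hτ.2)))

/-- The exponential change of variables in the period integral. -/
lemma period_integral_eq {A : ℝ → ℝ}
    (hA : ∀ u, A u = 2 * u ^ 2 - u ^ 2 * Real.log (u ^ 2)) {r σ : ℝ} (hr : 0 < r) (hσ : 0 < σ)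
    (h : (1 - Real.log r) * energyCoeff σ = 2 * σ) :
    ∫ φ in r..(r * Real.exp σ), (Real.sqrt (A φ - 3 / 4 * A r))⁻¹ =
      ∫ τ in (0 : ℝ)..1, (Real.sqrt (scaledEnergy σ τ))⁻¹ := by
  have hk := energyCoeff_pos hσ.le
  have hmono : Monotone fun τ => r * Real.exp (σ * τ) := by
    intro x y hxy
    simp only
    gcongr
  have hd (τ : ℝ) : HasDerivAt (fun τ => r * Real.exp (σ * τ)) (σ * (r * Real.exp (σ * τ))) τ := by
    have h : HasDerivAt (fun τ : ℝ => σ * τ) σ τ := by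
      simpa using (hasDerivAt_id τ).const_mul σ
    convert! h.exp.const_mul r using 1
    ring
  have himg : (fun τ => r * Real.exp (σ * τ)) '' Icc 0 1 = Icc r (r * Real.exp σ) := by
    have hc : ContinuousOn (fun τ => r * Real.exp (σ * τ)) (Icc 0 1) := by fun_prop
    simpa using hc.image_Icc_of_monotoneOn zero_le_one (hmono.monotoneOn _)
  have hle : r ≤ r * Real.exp σ := le_mul_of_one_le_right hr.le (Real.one_le_exp hσ.le)
  rw [intervalIntegral.integral_of_le hle, intervalIntegral.integral_of_le zero_le_one,
    ← integral_Icc_eq_integral_Ioc, ← integral_Icc_eq_integral_Ioc, ← himg,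
    integral_image_eq_integral_deriv_smul_of_monotoneOn measurableSet_Icc
      (fun τ _ => (hd τ).hasDerivWithinAt) (hmono.monotoneOn _)]
  refine setIntegral_congr_fun measurableSet_Icc fun τ _ => ?_
  have hpos : 0 < σ * (r * Real.exp (σ * τ)) := by positivity
  have hE : Real.exp (-2 * (σ * τ)) * Real.exp (σ * τ) ^ 2 = 1 := by
    rw [← Real.exp_nat_mul, ← Real.exp_add]
    norm_num
  have energy : A (r * Real.exp (σ * τ)) - 3 / 4 * A r =
      (σ * (r * Real.exp (σ * τ))) ^ 2 * scaledEnergy σ τ := by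
    have ha : 1 - Real.log r = 2 * σ / energyCoeff σ := by
      rw [eq_div_iff hk.ne', h]
    have hs : σ ^ 2 * scaledEnergy σ τ =
        (1 - Real.log r) * energyCoeff (σ * τ) - 2 * (σ * τ) := by
      rw [ha, scaledEnergy]
      field_simp
    rw [mul_pow, mul_right_comm, hs, hA, hA, Real.log_pow, Real.log_pow,
      Real.log_mul hr.ne' (Real.exp_pos _).ne', Real.log_exp, energyCoeff]
    push_cast
    linear_combination (3 / 2 * r ^ 2 * (1 - Real.log r)) * hE
  simp only [smul_eq_mul]
  rw [energy, Real.sqrt_mul (sq_nonneg _), Real.sqrt_sq hpos.le, mul_inv,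
    mul_inv_cancel_left₀ hpos.ne']

/-- The logarithm `σ` of the ratio of the turning point `p` to the boundary value `r` is positive
and is determined by `r`. -/
lemma log_ratio_pos_and_eq {A : ℝ → ℝ}
    (hA : ∀ u, A u = 2 * u ^ 2 - u ^ 2 * Real.log (u ^ 2)) {r p : ℝ}
    (hr : r ∈ Ioo 0 (Real.exp 1)) (hp : p ∈ Ioo (Real.sqrt (Real.exp 1)) (Real.exp 1))
    (h : A p = 3 / 4 * A r) :
    0 < Real.log p - Real.log r ∧
      (1 - Real.log r) * energyCoeff (Real.log p - Real.log r) =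
        2 * (Real.log p - Real.log r) := by
  have hr0 : 0 < r := hr.1
  have hp0 : 0 < p := (Real.sqrt_nonneg _).trans_lt hp.1
  have ha : Real.log r < 1 := (Real.log_lt_iff_lt_exp hr0).2 hr.2
  have hb : 1 / 2 < Real.log p := by
    have := Real.log_lt_log (Real.sqrt_pos.2 (Real.exp_pos 1)) hp.1
    rwa [Real.log_sqrt (Real.exp_pos 1).le, Real.log_exp] at this
  obtain ⟨σ, hσ⟩ : ∃ σ, σ = Real.log p - Real.log r := ⟨_, rfl⟩
  have hrE : r ^ 2 = p ^ 2 * Real.exp (-2 * σ) := by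
    rw [hσ, ← Real.exp_log hr0, ← Real.exp_log hp0, ← Real.exp_nat_mul, ← Real.exp_nat_mul,
      ← Real.exp_add, Real.log_exp, Real.log_exp]
    congr 1
    push_cast
    ring
  have hrel : 2 * (1 - Real.log p) = 3 / 2 * (1 - Real.log r) * Real.exp (-2 * σ) := by
    rw [hA, hA, Real.log_pow, Real.log_pow, hrE] at h
    push_cast at h
    have : p ^ 2 ≠ 0 := by positivity
    apply mul_left_cancel₀ this
    linear_combination h
  rw [← hσ]
  constructor
  · by_contra! hneg
    have h1 := Real.add_one_le_exp (2 * σ)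
    have hE : Real.exp (-2 * σ) * Real.exp (2 * σ) = 1 := by
      rw [← Real.exp_add]
      norm_num
    have hb1 : 0 < 1 - Real.log p := by
      have := Real.exp_pos (-2 * σ)
      nlinarith [mul_pos (sub_pos.2 ha) this]
    have h2 : 2 * (1 - Real.log p) * Real.exp (2 * σ) = 3 / 2 * (1 - Real.log r) := by
      rw [hrel, mul_assoc, hE, mul_one]
    nlinarith
  · rw [energyCoeff]
    linear_combination hrel - 2 * hσ

lemma log_ratio_lt_of_lt {a₁ a₂ σ₁ σ₂ : ℝ} (hσ₁ : 0 < σ₁) (hσ₂ : 0 < σ₂)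
    (h₁ : a₁ * energyCoeff σ₁ = 2 * σ₁) (h₂ : a₂ * energyCoeff σ₂ = 2 * σ₂) (h : a₁ < a₂) :
    σ₁ < σ₂ := by
  by_contra! hle
  have hk₁ := energyCoeff_pos hσ₁.le
  have hk₂ := energyCoeff_pos hσ₂.le
  have hτ : σ₂ / σ₁ ≤ 1 := (div_le_one hσ₁).2 hle
  have key := half_one_sub_le_energyCoeff_sub (σ := σ₁) (by positivity) hτ
  rw [mul_div_cancel₀ _ hσ₁.ne'] at key
  have key' : σ₂ * energyCoeff σ₁ ≤ σ₁ * energyCoeff σ₂ := by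
    have : σ₂ / σ₁ * energyCoeff σ₁ ≤ energyCoeff σ₂ := by linarith
    rw [div_mul_eq_mul_div, div_le_iff₀ hσ₁] at this
    linarith
  have : a₁ * (energyCoeff σ₁ * energyCoeff σ₂) < a₂ * (energyCoeff σ₁ * energyCoeff σ₂) := by
    gcongr
  nlinarith


/-- Lemma 5.2: The period function
`T r₀ = ∫_{r₀}^{r₊(r₀)} (A φ - (3/4) A r₀)^{-1/2} dφ` is strictly decreasing on `(0, e)`. -/
theorem period_function_strictAnti (A : ℝ → ℝ)
    (hA : ∀ u, A u = 2 * u ^ 2 - u ^ 2 * Real.log (u ^ 2))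
    (rp : ℝ → ℝ)
    (hrp : ∀ r₀ ∈ Set.Ioo (0 : ℝ) (Real.exp 1),
      rp r₀ ∈ Set.Ioo (Real.sqrt (Real.exp 1)) (Real.exp 1) ∧
        A (rp r₀) = 3 / 4 * A r₀)
    (T : ℝ → ℝ)
    (hT : ∀ r₀ ∈ Set.Ioo (0 : ℝ) (Real.exp 1),
      T r₀ = ∫ φ in r₀..(rp r₀), (Real.sqrt (A φ - 3 / 4 * A r₀))⁻¹) :
    StrictAntiOn T (Set.Ioo 0 (Real.exp 1)) := by
  intro r hr s hs hrs
  obtain ⟨hpr, hAr⟩ := hrp r hr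
  obtain ⟨hps, hAs⟩ := hrp s hs
  obtain ⟨hσr, er⟩ := log_ratio_pos_and_eq hA hr hpr hAr
  obtain ⟨hσs, es⟩ := log_ratio_pos_and_eq hA hs hps hAs
  have period : ∀ r ∈ Ioo 0 (Real.exp 1), 0 < Real.log (rp r) - Real.log r →
      (1 - Real.log r) * energyCoeff (Real.log (rp r) - Real.log r) =
        2 * (Real.log (rp r) - Real.log r) →
      T r = ∫ τ in (0 : ℝ)..1,
        (Real.sqrt (scaledEnergy (Real.log (rp r) - Real.log r) τ))⁻¹ := by
    intro r hr hσ he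
    have hp : 0 < rp r := (Real.sqrt_nonneg _).trans_lt (hrp r hr).1.1
    rw [hT r hr, ← period_integral_eq hA hr.1 hσ he, Real.exp_sub, Real.exp_log hp,
      Real.exp_log hr.1, mul_div_cancel₀ _ hr.1.ne']
  rw [period r hr hσr er, period s hs hσs es]
  refine integral_inv_sqrt_scaledEnergy_strictMonoOn hσs hσr
    (log_ratio_lt_of_lt hσs hσr es er ?_)
  linarith [Real.log_lt_log hr.1 hrs]
end

section
/- Define A(u) = 2u² − u²·log(u²) for u > 0, for r₀ ∈ (0, e) let r₊(r₀) be the unique point of (√e, e) with A(r₊(r₀)) = (3/4)·A(r₀), and let T(r₀) = ∫_{r₀}^{r₊(r₀)} (A(φ) − (3/4)·A(r₀))^{−1/2} dφ. Then T(r₀) → 0 as r₀ → e from the left. -/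
open Filter

/-- For `a ≥ 1/2`, on `[e^a, ∞)` the function `u ↦ 2u² - u² log u²` decreases at rate at least
`4a - 2`. -/
lemma antitoneOn_two_mul_sq_sub_sq_mul_log_add {a : ℝ} (ha : 1 / 2 ≤ a) :
    AntitoneOn (fun u : ℝ => 2 * u ^ 2 - u ^ 2 * Real.log (u ^ 2) + (4 * a - 2) * u)
      (Set.Ici (Real.exp a)) := by
  have hderiv : ∀ u : ℝ, 0 < u →
      HasDerivAt (fun u : ℝ => 2 * u ^ 2 - u ^ 2 * Real.log (u ^ 2) + (4 * a - 2) * u)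
        (2 * u - 4 * u * Real.log u + (4 * a - 2)) u := by
    intro u hu
    have hsq : HasDerivAt (fun u : ℝ => u ^ 2) (2 * u) u := by
      simpa using hasDerivAt_pow 2 u
    have hlog := hsq.log (by positivity)
    have h := ((hsq.const_mul 2).sub (hsq.mul hlog)).add ((hasDerivAt_id u).const_mul (4 * a - 2))
    refine h.congr_deriv ?_
    rw [Real.log_pow]
    field_simp
    push_cast
    ring
  have hpos : ∀ u ∈ Set.Ici (Real.exp a), 0 < u := fun u hu =>
    (Real.exp_pos _).trans_le hu
  refine antitoneOn_of_deriv_nonpos (convex_Ici _)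
    (fun u hu => (hderiv u (hpos u hu)).continuousAt.continuousWithinAt)
    (fun u hu => (hderiv u (hpos u (interior_subset hu))).differentiableAt.differentiableWithinAt)
    (fun u hu => ?_)
  have hu' : Real.exp a ≤ u := interior_subset hu
  have hu0 := hpos u hu'
  rw [(hderiv u hu0).deriv]
  have hlog : a ≤ Real.log u := (Real.le_log_iff_exp_le hu0).2 hu'
  have hone : 1 ≤ u := (Real.one_le_exp (by linarith)).trans hu'
  nlinarith [mul_le_mul_of_nonneg_left hlog hu0.le,
    mul_nonneg (sub_nonneg.2 hone) (sub_nonneg.2 ha)]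

/-- An integrand bounded by the inverse square root of the distance to the right endpoint has
integral at most `2 √(b - a)`. -/
lemma norm_integral_le_two_mul_sqrt {f : ℝ → ℝ} {a b : ℝ} (hab : a ≤ b)
    (hf : ∀ x ∈ Set.Ioc a b, ‖f x‖ ≤ (b - x) ^ (-(1 / 2) : ℝ)) :
    ‖∫ x in a..b, f x‖ ≤ 2 * Real.sqrt (b - a) := by
  have hint : IntervalIntegrable (fun x : ℝ => (b - x) ^ (-(1 / 2) : ℝ))
      MeasureTheory.volume a b := by
    have h := (intervalIntegral.intervalIntegrable_rpow' (a := b - a) (b := 0)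
      (r := -(1 / 2)) (by norm_num)).comp_sub_left b
    simpa using h
  refine (intervalIntegral.norm_integral_le_of_norm_le hab
    (Eventually.of_forall hf) hint).trans_eq ?_
  rw [intervalIntegral.integral_comp_sub_left (fun x : ℝ => x ^ (-(1 / 2) : ℝ)) b, sub_self,
    integral_rpow (Or.inl (by norm_num)), Real.sqrt_eq_rpow]
  norm_num
  ring

/-- The period function
`T r₀ = ∫_{r₀}^{r₊(r₀)} (A φ - (3/4) A r₀)^{-1/2} dφ` tends to `0` as `r₀ → e⁻`. -/
theorem period_function_tendsto_zero (A : ℝ → ℝ)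
    (hA : ∀ u, A u = 2 * u ^ 2 - u ^ 2 * Real.log (u ^ 2))
    (rp : ℝ → ℝ)
    (hrp : ∀ r₀ ∈ Set.Ioo (0 : ℝ) (Real.exp 1),
      rp r₀ ∈ Set.Ioo (Real.sqrt (Real.exp 1)) (Real.exp 1) ∧
        A (rp r₀) = 3 / 4 * A r₀)
    (T : ℝ → ℝ)
    (hT : ∀ r₀ ∈ Set.Ioo (0 : ℝ) (Real.exp 1),
      T r₀ = ∫ φ in r₀..(rp r₀), (Real.sqrt (A φ - 3 / 4 * A r₀))⁻¹) :
    Tendsto T (nhdsWithin (Real.exp 1) (Set.Iio (Real.exp 1))) (nhds 0) := by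
  have hanti : ∀ x y, Real.exp (3 / 4) ≤ x → x ≤ y → y - x ≤ A x - A y := by
    intro x y hx hxy
    have h := antitoneOn_two_mul_sq_sub_sq_mul_log_add (a := 3 / 4)
      (by norm_num) hx (hx.trans hxy) hxy
    simp only [← hA] at h
    linarith
  have hbound : ∀ r ∈ Set.Ioo (Real.exp (3 / 4)) (Real.exp 1),
      ‖T r‖ ≤ 2 * Real.sqrt (Real.exp 1 - r) := by
    rintro r ⟨hr, hre⟩
    have hr0 : r ∈ Set.Ioo (0 : ℝ) (Real.exp 1) := ⟨(Real.exp_pos _).trans hr, hre⟩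
    obtain ⟨⟨hsp, hpe⟩, hp⟩ := hrp r hr0
    have hAe : A (Real.exp 1) = 0 := by
      rw [hA, Real.log_pow, Real.log_exp]
      push_cast
      ring
    have hApos : 0 < A r := by
      linarith [hanti r (Real.exp 1) hr.le hre.le]
    have hrlt : r ≤ rp r := by
      by_contra! hlt
      rw [← Real.exp_half] at hsp
      have h := antitoneOn_two_mul_sq_sub_sq_mul_log_add le_rfl hsp.le (hsp.trans hlt).le hlt.le
      simp only [← hA] at h
      linarith
    rw [hT r hr0]
    refine (norm_integral_le_two_mul_sqrt hrlt fun x hx => ?_).trans (by gcongr)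
    have hx0 : 0 ≤ rp r - x := sub_nonneg.2 hx.2
    rw [← hp, Real.rpow_neg hx0, ← Real.sqrt_eq_rpow, Real.norm_of_nonneg (by positivity)]
    rcases hx0.eq_or_lt with h | h
    · rw [← sub_eq_zero.1 h.symm]
      simp
    · exact inv_anti₀ (Real.sqrt_pos.2 h)
        (Real.sqrt_le_sqrt (hanti x (rp r) (hr.le.trans hx.1.le) hx.2))
  refine squeeze_zero_norm' (a := fun r => 2 * Real.sqrt (Real.exp 1 - r)) ?_ ?_
  · filter_upwards [Ioo_mem_nhdsLT (Real.exp_lt_exp.2 (by norm_num : (3 / 4 : ℝ) < 1))]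
      with r hr using hbound r hr
  · have h : Continuous fun r : ℝ => 2 * Real.sqrt (Real.exp 1 - r) := by fun_prop
    simpa using (h.tendsto (Real.exp 1)).mono_left nhdsWithin_le_nhds
end

section
/- Define A(u) = 2u² − u²·log(u²) for u > 0, for r₀ ∈ (0, e) let r₊(r₀) be the unique point of (√e, e) with A(r₊(r₀)) = (3/4)·A(r₀), and let T(r₀) = ∫_{r₀}^{r₊(r₀)} (A(φ) − (3/4)·A(r₀))^{−1/2} dφ. Then T(r₀) → +∞ as r₀ → 0 from the right. -/
open Filter

/-- If `u² (2 - log u²)` takes the value `3/4 * m` at `r` and `m` at `a < r`, then by concavity in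
`u²` it exceeds `3/4 * m` by at least a multiple of `r - x` for `x ∈ [a, r]`. -/
lemma sq_mul_two_sub_log_chord_bound {a r x m : ℝ} (ha : 0 < a) (har : a < r)
    (hm : 0 ≤ m) (hAa : 2 * a ^ 2 - a ^ 2 * Real.log (a ^ 2) = m)
    (hAr : 2 * r ^ 2 - r ^ 2 * Real.log (r ^ 2) = 3 / 4 * m)
    (hax : a ≤ x) (hxr : x ≤ r) :
    m / 4 * r / (r ^ 2 - a ^ 2) * (r - x) ≤
      2 * x ^ 2 - x ^ 2 * Real.log (x ^ 2) - 3 / 4 * m := by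
  have hd : 0 < r ^ 2 - a ^ 2 := by nlinarith
  have hp : 0 ≤ r ^ 2 - x ^ 2 := by nlinarith
  have hq : 0 ≤ x ^ 2 - a ^ 2 := by nlinarith
  have hp' : 0 ≤ (r ^ 2 - x ^ 2) / (r ^ 2 - a ^ 2) := by positivity
  have hq' : 0 ≤ (x ^ 2 - a ^ 2) / (r ^ 2 - a ^ 2) := by positivity
  have hconv := Real.convexOn_mul_log.2 (Set.mem_Ici.2 (sq_nonneg a)) (Set.mem_Ici.2 (sq_nonneg r))
    hp' hq' (by field_simp; ring)
  simp only [smul_eq_mul] at hconv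
  have hx : (r ^ 2 - x ^ 2) / (r ^ 2 - a ^ 2) * a ^ 2
      + (x ^ 2 - a ^ 2) / (r ^ 2 - a ^ 2) * r ^ 2 = x ^ 2 := by
    field_simp; ring
  have ha' : a ^ 2 * Real.log (a ^ 2) = 2 * a ^ 2 - m := by linarith
  have hr' : r ^ 2 * Real.log (r ^ 2) = 2 * r ^ 2 - 3 / 4 * m := by linarith
  rw [hx, ha', hr'] at hconv
  have hval : (r ^ 2 - x ^ 2) / (r ^ 2 - a ^ 2) * (2 * a ^ 2 - m)
      + (x ^ 2 - a ^ 2) / (r ^ 2 - a ^ 2) * (2 * r ^ 2 - 3 / 4 * m)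
      = 2 * x ^ 2 - 3 / 4 * m - m / 4 / (r ^ 2 - a ^ 2) * (r ^ 2 - x ^ 2) := by
    field_simp; ring
  have hlin : m / 4 / (r ^ 2 - a ^ 2) * (r * (r - x)) ≤
      m / 4 / (r ^ 2 - a ^ 2) * (r ^ 2 - x ^ 2) := by
    gcongr
    nlinarith
  have he : m / 4 * r / (r ^ 2 - a ^ 2) * (r - x) =
      m / 4 / (r ^ 2 - a ^ 2) * (r * (r - x)) := by ring
  linarith

/-- A function bounded below by `c * (r - x)` on `[a, r]` has integrable inverse square root. -/
lemma integrableOn_inv_sqrt_of_le {f : ℝ → ℝ} {a r c : ℝ} (har : a ≤ r) (hc : 0 < c)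
    (hf : Measurable f) (hle : ∀ x ∈ Set.Icc a r, c * (r - x) ≤ f x) :
    MeasureTheory.IntegrableOn (fun x => (Real.sqrt (f x))⁻¹) (Set.Icc a r) := by
  rw [integrableOn_Icc_iff_integrableOn_Ioo]
  have hpow : IntervalIntegrable (fun x : ℝ => (r - x) ^ (-(1 / 2) : ℝ))
      MeasureTheory.volume a r := by
    have h := (intervalIntegral.intervalIntegrable_rpow' (a := r - a) (b := 0)
      (r := -(1 / 2)) (by norm_num)).comp_sub_left r
    simpa using h
  have hbound : MeasureTheory.IntegrableOn
      (fun x : ℝ => (Real.sqrt c)⁻¹ * (r - x) ^ (-(1 / 2) : ℝ)) (Set.Ioo a r) :=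
    (((intervalIntegrable_iff_integrableOn_Ioo_of_le har).1 hpow).const_mul _)
  refine MeasureTheory.Integrable.mono' hbound hf.sqrt.inv.aestronglyMeasurable ?_
  refine (MeasureTheory.ae_restrict_iff' measurableSet_Ioo).2 (Eventually.of_forall ?_)
  intro x hx
  have hrx : 0 < r - x := sub_pos.2 hx.2
  rw [Real.norm_of_nonneg (by positivity), Real.rpow_neg hrx.le, ← Real.sqrt_eq_rpow,
    ← mul_inv, ← Real.sqrt_mul hc.le]
  exact inv_anti₀ (Real.sqrt_pos.2 (by positivity))
    (Real.sqrt_le_sqrt (hle x (Set.Ioo_subset_Icc_self hx)))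

lemma hasDerivAt_neg_sqrt_two_sub_log_sq {x : ℝ} (hx : 0 < x) (hlog : Real.log (x ^ 2) < 2) :
    HasDerivAt (fun y => -Real.sqrt (2 - Real.log (y ^ 2)))
      (Real.sqrt (2 * x ^ 2 - x ^ 2 * Real.log (x ^ 2)))⁻¹ x := by
  have hpos : 0 < 2 - Real.log (x ^ 2) := sub_pos.2 hlog
  have h := ((((hasDerivAt_pow 2 x).log (by positivity)).const_sub 2).sqrt hpos.ne').neg
  refine h.congr_deriv ?_
  have he : 2 * x ^ 2 - x ^ 2 * Real.log (x ^ 2) = x ^ 2 * (2 - Real.log (x ^ 2)) := by ring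
  rw [he, Real.sqrt_mul (sq_nonneg x), Real.sqrt_sq hx.le]
  have := Real.sqrt_pos.2 hpos
  field_simp
  norm_num
  ring

/-- The period function
`T r₀ = ∫_{r₀}^{r₊(r₀)} (A φ - (3/4) A r₀)^{-1/2} dφ` tends to `+∞` as `r₀ → 0⁺`. -/
theorem period_function_tendsto_atTop (A : ℝ → ℝ)
    (hA : ∀ u, A u = 2 * u ^ 2 - u ^ 2 * Real.log (u ^ 2))
    (rp : ℝ → ℝ)
    (hrp : ∀ r₀ ∈ Set.Ioo (0 : ℝ) (Real.exp 1),
      rp r₀ ∈ Set.Ioo (Real.sqrt (Real.exp 1)) (Real.exp 1) ∧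
        A (rp r₀) = 3 / 4 * A r₀)
    (T : ℝ → ℝ)
    (hT : ∀ r₀ ∈ Set.Ioo (0 : ℝ) (Real.exp 1),
      T r₀ = ∫ φ in r₀..(rp r₀), (Real.sqrt (A φ - 3 / 4 * A r₀))⁻¹) :
    Tendsto T (nhdsWithin 0 (Set.Ioi 0)) atTop := by
  have hlog_lt : ∀ x : ℝ, 0 < x → x < Real.exp 1 → Real.log (x ^ 2) < 2 := by
    intro x hx hxe
    have h := (Real.log_lt_iff_lt_exp hx).2 hxe
    rw [Real.log_pow]
    push_cast
    linarith
  have hApos : ∀ x : ℝ, 0 < x → x < Real.exp 1 → 0 < A x := by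
    intro x hx hxe
    have h := mul_pos (pow_pos hx 2) (sub_pos.2 (hlog_lt x hx hxe))
    rw [hA]
    linarith
  have hAmeas : Measurable A := by
    rw [funext hA]
    fun_prop
  have hlower : ∀ a : ℝ, 0 < a → a < 1 → Real.sqrt (2 - Real.log (a ^ 2)) - 1 ≤ T a := by
    intro a ha ha1
    have hae : a < Real.exp 1 := ha1.trans (Real.one_lt_exp_iff.2 one_pos)
    obtain ⟨⟨hr1, hr2⟩, hAr⟩ := hrp a ⟨ha, hae⟩
    rw [hT a ⟨ha, hae⟩]
    set r := rp a
    have har : a < r := by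
      have h1 : 1 < Real.sqrt (Real.exp 1) :=
        Real.lt_sqrt_of_sq_lt (by simp)
      linarith
    have hr0 : 0 < r := ha.trans har
    have hm := hApos a ha hae
    have hd : 0 < r ^ 2 - a ^ 2 := by nlinarith
    have hc : 0 < A a / 4 * r / (r ^ 2 - a ^ 2) := by positivity
    have hbound : ∀ x ∈ Set.Icc a r,
        A a / 4 * r / (r ^ 2 - a ^ 2) * (r - x) ≤ A x - 3 / 4 * A a := by
      intro x hx
      rw [hA x]
      exact sq_mul_two_sub_log_chord_bound ha har hm.le (hA a).symm
        ((hA r).symm.trans hAr) hx.1 hx.2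
    have hderiv : ∀ x ∈ Set.Icc a r, HasDerivAt (fun y => -Real.sqrt (2 - Real.log (y ^ 2)))
        (Real.sqrt (A x))⁻¹ x := by
      intro x hx
      have hx0 := ha.trans_le hx.1
      rw [hA x]
      exact hasDerivAt_neg_sqrt_two_sub_log_sq hx0 (hlog_lt x hx0 (hx.2.trans_lt hr2))
    have hint := intervalIntegral.sub_le_integral_of_hasDeriv_right_of_le har.le
      (fun x hx => (hderiv x hx).continuousAt.continuousWithinAt)
      (fun x hx => (hderiv x (Set.Ioo_subset_Icc_self hx)).hasDerivWithinAt)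
      (integrableOn_inv_sqrt_of_le har.le hc (hAmeas.sub_const _) hbound)
      (fun x hx => by
        have hpos : 0 < A x - 3 / 4 * A a :=
          (mul_pos hc (sub_pos.2 hx.2)).trans_le (hbound x (Set.Ioo_subset_Icc_self hx))
        exact inv_anti₀ (Real.sqrt_pos.2 hpos) (Real.sqrt_le_sqrt (by linarith)))
    have hlogr : 1 ≤ Real.log (r ^ 2) := by
      rw [Real.le_log_iff_exp_le (by positivity)]
      exact ((Real.sqrt_lt' hr0).1 hr1).le
    have hend : Real.sqrt (2 - Real.log (r ^ 2)) ≤ 1 :=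
      Real.sqrt_le_one.2 (by linarith)
    linarith
  have hlim : Tendsto (fun a : ℝ => Real.sqrt (2 - Real.log (a ^ 2)) - 1)
      (nhdsWithin 0 (Set.Ioi 0)) atTop := by
    refine tendsto_atTop_add_const_right _ (-1) (Real.tendsto_sqrt_atTop.comp ?_)
    have h : Tendsto (fun a : ℝ => 2 + -(2 * Real.log a)) (nhdsWithin 0 (Set.Ioi 0)) atTop :=
      tendsto_atTop_add_const_left _ 2 (tendsto_neg_atBot_atTop.comp
        (Real.tendsto_log_nhdsGT_zero.const_mul_atBot two_pos))
    refine h.congr fun a => ?_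
    rw [Real.log_pow]
    push_cast
    ring
  refine tendsto_atTop_mono' _ ?_ hlim
  filter_upwards [Ioo_mem_nhdsGT (zero_lt_one' ℝ)] with a ha using hlower a ha.1 ha.2
end

section
/- Define A(u) = 2u² − u²·log(u²) for u > 0, for r₀ ∈ (0, e) let r₊(r₀) be the unique point of (√e, e) with A(r₊(r₀)) = (3/4)·A(r₀), and let T(r₀) = ∫_{r₀}^{r₊(r₀)} (A(φ) − (3/4)·A(r₀))^{−1/2} dφ. Then for every ℓ > 0 there exists a unique r₀ ∈ (0, e) such that T(r₀) = ℓ. -/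
open Real Set Filter Topology MeasureTheory

/-- `(eˣ - 1 - x) / x²`, extended smoothly through `x = 0`. -/
noncomputable def expQuot (x : ℝ) : ℝ := ∫ t in (0 : ℝ)..1, (1 - t) * exp (x * t)

lemma sq_mul_expQuot (x : ℝ) : x ^ 2 * expQuot x = exp x - 1 - x := by
  have h : ∀ t : ℝ, HasDerivAt (fun t => (1 - t) * (x * exp (x * t)) + exp (x * t))
      (x ^ 2 * ((1 - t) * exp (x * t))) t := by
    intro t
    have he : HasDerivAt (fun t => exp (x * t)) (exp (x * t) * x) t := by
      simpa using ((hasDerivAt_id t).const_mul x).exp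
    have h1 : HasDerivAt (fun t : ℝ => 1 - t) (-1) t := by
      simpa using (hasDerivAt_id t).const_sub 1
    exact ((h1.mul (he.const_mul x)).add he).congr_deriv (by ring)
  rw [expQuot, ← intervalIntegral.integral_const_mul,
    intervalIntegral.integral_eq_sub_of_hasDerivAt (fun t _ => h t)
      (Continuous.intervalIntegrable (by fun_prop) _ _)]
  simp
  ring

lemma continuous_expQuot : Continuous expQuot :=
  intervalIntegral.continuous_parametric_intervalIntegral_of_continuous'
    (f := fun x t : ℝ => (1 - t) * exp (x * t)) (by fun_prop) 0 1

lemma monotone_expQuot : Monotone expQuot := by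
  intro a b hab
  refine intervalIntegral.integral_mono_on zero_le_one
    (Continuous.intervalIntegrable (by fun_prop) _ _)
    (Continuous.intervalIntegrable (by fun_prop) _ _) fun t ht => ?_
  have := sub_nonneg.2 ht.2
  have := ht.1
  gcongr

lemma expQuot_pos (x : ℝ) : 0 < expQuot x :=
  intervalIntegral.intervalIntegral_pos_of_pos_on
    (Continuous.intervalIntegrable (by fun_prop) _ _)
    (fun t ht => mul_pos (sub_pos.2 ht.2) (exp_pos _)) zero_lt_one

lemma expQuot_sub_le {a b : ℝ} (hab : a ≤ b) (hb : b ≤ 0) :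
    expQuot b - expQuot a ≤ (b - a) / 6 := by
  have hint : ∫ t in (0 : ℝ)..1, (1 - t) * ((b - a) * t) = (b - a) / 6 := by
    rw [intervalIntegral.integral_eq_sub_of_hasDerivAt
      (f := fun t => (b - a) * (t ^ 2 / 2 - t ^ 3 / 3)) (fun t _ => ?_)
      (Continuous.intervalIntegrable (by fun_prop) _ _)]
    · ring
    · refine ((((hasDerivAt_pow 2 t).div_const 2).sub
        ((hasDerivAt_pow 3 t).div_const 3)).const_mul (b - a)).congr_deriv ?_
      push_cast
      ring
  rw [← hint, expQuot, expQuot, ← intervalIntegral.integral_sub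
    (Continuous.intervalIntegrable (by fun_prop) _ _)
    (Continuous.intervalIntegrable (by fun_prop) _ _)]
  refine intervalIntegral.integral_mono_on zero_le_one
    (Continuous.intervalIntegrable (by fun_prop) _ _)
    (Continuous.intervalIntegrable (by fun_prop) _ _) fun t ht => ?_
  rw [← mul_sub]
  refine mul_le_mul_of_nonneg_left ?_ (sub_nonneg.2 ht.2)
  have h1 : exp (a * t) = exp (b * t) * exp ((a - b) * t) := by
    rw [← exp_add]
    ring_nf
  have h2 : (a - b) * t + 1 ≤ exp ((a - b) * t) := add_one_le_exp _
  have h3 : exp (b * t) ≤ 1 := exp_le_one_iff.2 (mul_nonpos_of_nonpos_of_nonneg hb ht.1)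
  have h4 : 0 ≤ (b - a) * t := mul_nonneg (sub_nonneg.2 hab) ht.1
  rw [h1]
  nlinarith [exp_pos (b * t)]

lemma one_fourth_le_expQuot {x : ℝ} (hx : -1 ≤ x) : 1 / 4 ≤ expQuot x := by
  refine le_trans ?_ (monotone_expQuot hx)
  have h := sq_mul_expQuot (-1)
  have h1 : exp (-1) * exp 1 = 1 := by rw [← exp_add]; simp
  nlinarith [exp_one_lt_d9, exp_pos (-1)]

/-- The transformed integrand of the period function, in the variable `w = 2 log u - 1`. -/
noncomputable def weight (w : ℝ) : ℝ := √(expQuot (-w))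

lemma weight_pos (w : ℝ) : 0 < weight w := sqrt_pos.2 (expQuot_pos _)

lemma weight_sq (w : ℝ) : weight w ^ 2 = expQuot (-w) := sq_sqrt (expQuot_pos _).le

lemma continuous_weight : Continuous weight :=
  (continuous_expQuot.comp continuous_neg).sqrt

lemma antitone_weight : Antitone weight := fun _ _ h =>
  sqrt_le_sqrt (monotone_expQuot (neg_le_neg h))

lemma weight_sub_le {a b : ℝ} (ha : 0 ≤ a) (hab : a ≤ b) (hb : b ≤ 1) :
    weight a - weight b ≤ (b - a) / 6 := by
  have hlow : ∀ w ≤ 1, 1 / 2 ≤ weight w := fun w hw =>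
    le_sqrt_of_sq_le (by linarith [one_fourth_le_expQuot (neg_le_neg hw)])
  have h1 := hlow a (hab.trans hb)
  have h2 := hlow b hb
  have h3 := expQuot_sub_le (neg_le_neg hab) (neg_nonpos.2 ha)
  rw [← weight_sq, ← weight_sq] at h3
  nlinarith [antitone_weight hab]

/-- The coordinate `y` in which the potential `u² (2 - log u²)` becomes `e (1 - y²)`,
as a function of `w = 2 log u - 1`. -/
noncomputable def potCoord (w : ℝ) : ℝ := w * (exp (w / 2) * weight w)

lemma potCoord_sq (w : ℝ) : potCoord w ^ 2 = 1 - exp w * (1 - w) := by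
  have h1 : exp (w / 2) ^ 2 = exp w := by rw [← exp_nat_mul]; ring_nf
  have h2 := sq_mul_expQuot (-w)
  have h3 : exp w * exp (-w) = 1 := by rw [← exp_add]; simp
  rw [potCoord, mul_pow, mul_pow, h1, weight_sq]
  linear_combination exp w * h2 + h3

lemma continuous_potCoord : Continuous potCoord := by
  have := continuous_weight
  unfold potCoord
  fun_prop

lemma potCoord_zero : potCoord 0 = 0 := by simp [potCoord]

lemma potCoord_pos {w : ℝ} (hw : 0 < w) : 0 < potCoord w :=
  mul_pos hw (mul_pos (exp_pos _) (weight_pos _))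

lemma potCoord_neg {w : ℝ} (hw : w < 0) : potCoord w < 0 :=
  mul_neg_of_neg_of_pos hw (mul_pos (exp_pos _) (weight_pos _))

lemma hasDerivAt_potCoord (w : ℝ) :
    HasDerivAt potCoord (exp (w / 2) / (2 * weight w)) w := by
  have hG : ∀ y : ℝ, HasDerivAt (fun w => 1 - exp w * (1 - w)) (y * exp y) y := by
    intro y
    have h1 : HasDerivAt (fun t : ℝ => 1 - t) (-1) y := by
      simpa using (hasDerivAt_id y).const_sub 1
    exact (((hasDerivAt_exp y).mul h1).const_sub 1).congr_deriv (by ring)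
  have hval : ∀ y : ℝ, y ≠ 0 →
      y * exp y / (2 * potCoord y) = exp (y / 2) / (2 * weight y) := by
    intro y hy
    have h1 : exp (y / 2) ^ 2 = exp y := by rw [← exp_nat_mul]; ring_nf
    have h2 := (weight_pos y).ne'
    have h3 := (exp_pos (y / 2)).ne'
    rw [potCoord, ← h1]
    field_simp
  have hne : ∀ y : ℝ, y ≠ 0 → HasDerivAt potCoord (exp (y / 2) / (2 * weight y)) y := by
    intro y hy
    rw [← hval y hy]
    have hsqrt : ∀ z, √(1 - exp z * (1 - z)) = |potCoord z| := fun z => by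
      rw [← potCoord_sq, sqrt_sq_eq_abs]
    have hy0 : potCoord y ≠ 0 := mul_ne_zero hy (mul_pos (exp_pos _) (weight_pos _)).ne'
    have hd := (hG y).sqrt (by rw [← potCoord_sq]; exact pow_ne_zero 2 hy0)
    rw [hsqrt] at hd
    rcases hy.lt_or_gt with h | h
    · rw [abs_of_neg (potCoord_neg h)] at hd
      refine (hd.neg.congr_of_eventuallyEq ?_).congr_deriv (by field_simp)
      filter_upwards [Iio_mem_nhds h] with z hz
      simp [hsqrt, abs_of_neg (potCoord_neg hz)]
    · rw [abs_of_pos (potCoord_pos h)] at hd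
      refine hd.congr_of_eventuallyEq ?_
      filter_upwards [Ioi_mem_nhds h] with z hz
      simp [hsqrt, abs_of_pos (potCoord_pos hz)]
  have hcont : Continuous fun w => exp (w / 2) / (2 * weight w) :=
    (by fun_prop : Continuous fun w : ℝ => exp (w / 2)).div
      (continuous_const.mul continuous_weight) fun w => (mul_pos two_pos (weight_pos w)).ne'
  rcases eq_or_ne w 0 with rfl | hw
  · exact hasDerivAt_of_hasDerivAt_of_ne hne continuous_potCoord.continuousAt hcont.continuousAt
  · exact hne w hw

lemma strictMono_potCoord : StrictMono potCoord :=
  strictMono_of_deriv_pos fun w => by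
    rw [(hasDerivAt_potCoord w).deriv]
    exact div_pos (exp_pos _) (mul_pos two_pos (weight_pos w))

lemma potCoord_one : potCoord 1 = 1 := by
  have h := potCoord_sq 1
  have h1 := potCoord_pos one_pos
  nlinarith

lemma potCoord_lt_one {w : ℝ} (hw : w < 1) : potCoord w < 1 :=
  (strictMono_potCoord hw).trans_eq potCoord_one

lemma neg_one_lt_potCoord (w : ℝ) : -1 < potCoord w := by
  rcases lt_or_ge w 0 with h | h
  · have := potCoord_sq w
    nlinarith [mul_pos (exp_pos w) (by linarith : 0 < 1 - w)]
  · linarith [mul_nonneg h (mul_pos (exp_pos (w / 2)) (weight_pos w)).le,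
      show potCoord w = w * (exp (w / 2) * weight w) from rfl]

lemma sub_le_mul_potCoord_sub {a b : ℝ} (ha : 0 ≤ a) (hab : a ≤ b) :
    b - a ≤ 2 * weight 0 * (potCoord b - potCoord a) := by
  have h0 := mul_pos two_pos (weight_pos 0)
  have h := (convex_Ici (0 : ℝ)).mul_sub_le_image_sub_of_le_deriv (f := potCoord)
    (C := 1 / (2 * weight 0)) continuous_potCoord.continuousOn
    (fun w _ => (hasDerivAt_potCoord w).differentiableAt.differentiableWithinAt)
    (fun w hw => ?_) a ha b (ha.trans hab) hab
  · rw [div_mul_eq_mul_div, one_mul, div_le_iff₀ h0] at h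
    linarith
  · rw [interior_Ici] at hw
    rw [(hasDerivAt_potCoord w).deriv]
    have h1 := weight_pos w
    exact div_le_div₀ (exp_pos _).le (one_le_exp (by linarith [mem_Ioi.1 hw]))
      (mul_pos two_pos h1) (by linarith [antitone_weight hw.le])

lemma exists_potCoord_eq {y : ℝ} (hy : y ∈ Ioo (-1 : ℝ) 1) : ∃ w, potCoord w = y := by
  have hlim : Tendsto (fun x : ℝ => 1 - exp (-x) * (1 + x)) atTop (𝓝 1) := by
    have h0 := tendsto_pow_mul_exp_neg_atTop_nhds_zero 0
    have h1 := tendsto_pow_mul_exp_neg_atTop_nhds_zero 1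
    simpa using ((h0.add h1).const_sub 1).congr fun x => by ring
  obtain ⟨x, hx, hx0⟩ := ((hlim.eventually_const_lt
    ((sq_lt_one_iff_abs_lt_one y).2 (abs_lt.2 hy))).and (eventually_gt_atTop 0)).exists
  have h1 : potCoord (-x) < y := by
    have h2 := potCoord_sq (-x)
    rw [sub_neg_eq_add] at h2
    rw [← h2] at hx
    have h3 := abs_lt_of_sq_lt_sq hx
    have h4 := potCoord_neg (neg_lt_zero.2 hx0)
    rw [sq_lt_sq, abs_of_neg h4] at hx
    linarith [neg_abs_le y]
  have h2 : y < potCoord 1 := by rw [potCoord_one]; exact hy.2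
  obtain ⟨w, -, hw⟩ := intermediate_value_Ioo (by linarith) continuous_potCoord.continuousOn
    ⟨h1, h2⟩
  exact ⟨w, hw⟩

/-- The inverse of `potCoord`. -/
noncomputable def invCoord : ℝ → ℝ := Function.invFun potCoord

lemma invCoord_potCoord (w : ℝ) : invCoord (potCoord w) = w :=
  Function.leftInverse_invFun strictMono_potCoord.injective w

lemma potCoord_invCoord {y : ℝ} (hy : y ∈ Ioo (-1 : ℝ) 1) : potCoord (invCoord y) = y :=
  Function.invFun_eq (exists_potCoord_eq hy)

lemma invCoord_zero : invCoord 0 = 0 := by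
  rw [← potCoord_zero, invCoord_potCoord, potCoord_zero]

lemma strictMonoOn_invCoord : StrictMonoOn invCoord (Ioo (-1) 1) := fun a ha b hb hab => by
  rw [← strictMono_potCoord.lt_iff_lt, potCoord_invCoord ha, potCoord_invCoord hb]
  exact hab

lemma invCoord_lt_one {y : ℝ} (hy : y ∈ Ioo (-1 : ℝ) 1) : invCoord y < 1 := by
  rw [← strictMono_potCoord.lt_iff_lt, potCoord_invCoord hy, potCoord_one]
  exact hy.2

lemma continuousAt_invCoord {y : ℝ} (hy : y ∈ Ioo (-1 : ℝ) 1) : ContinuousAt invCoord y := by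
  refine strictMonoOn_invCoord.continuousAt_of_image_mem_nhds (Ioo_mem_nhds hy.1 hy.2) ?_
  have h : potCoord ⁻¹' Ioo (-1) 1 ∈ 𝓝 (invCoord y) :=
    (isOpen_Ioo.preimage continuous_potCoord).mem_nhds (by rwa [mem_preimage, potCoord_invCoord hy])
  exact mem_of_superset h fun w hw => ⟨potCoord w, hw, invCoord_potCoord w⟩

lemma hasDerivAt_invCoord {y : ℝ} (hy : y ∈ Ioo (-1 : ℝ) 1) :
    HasDerivAt invCoord (2 * weight (invCoord y) / exp (invCoord y / 2)) y := by
  have h := HasDerivAt.of_local_left_inverse (continuousAt_invCoord hy)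
    (hasDerivAt_potCoord (invCoord y))
    (div_pos (exp_pos _) (mul_pos two_pos (weight_pos _))).ne'
    (by filter_upwards [Ioo_mem_nhds hy.1 hy.2] with z hz using potCoord_invCoord hz)
  rwa [inv_div] at h

/-- The transformed integrand as a function of the coordinate `y`. -/
noncomputable def kern (y : ℝ) : ℝ := weight (invCoord y)

lemma kern_pos (y : ℝ) : 0 < kern y := weight_pos _

lemma antitoneOn_kern : AntitoneOn kern (Ioo (-1) 1) := fun _ ha _ hb h =>
  antitone_weight (strictMonoOn_invCoord.monotoneOn ha hb h)

lemma continuousOn_kern : ContinuousOn kern (Ioo (-1) 1) := fun _ hy =>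
  (continuous_weight.continuousAt.comp (continuousAt_invCoord hy)).continuousWithinAt

lemma kern_sub_le {a b : ℝ} (ha : 0 ≤ a) (hab : a ≤ b) (hb : b < 1) :
    kern a - kern b ≤ kern 0 / 3 * (b - a) := by
  have ha' : a ∈ Ioo (-1 : ℝ) 1 := ⟨by linarith, by linarith⟩
  have hb' : b ∈ Ioo (-1 : ℝ) 1 := ⟨by linarith, by linarith⟩
  have h0 : 0 ≤ invCoord a := by
    rw [← invCoord_zero]
    exact strictMonoOn_invCoord.monotoneOn (by norm_num) ha' ha
  have h1 := strictMonoOn_invCoord.monotoneOn ha' hb' hab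
  have h2 := weight_sub_le h0 h1 (invCoord_lt_one hb').le
  have h3 := sub_le_mul_potCoord_sub h0 h1
  rw [potCoord_invCoord ha', potCoord_invCoord hb'] at h3
  have h4 : kern 0 = weight 0 := by rw [kern, invCoord_zero]
  rw [h4]
  unfold kern
  linarith

/-- The amplitude `R` of the substitution `y = R sin θ` for the orbit starting at `y = η`. -/
noncomputable def amp (η : ℝ) : ℝ := √((1 + 3 * η ^ 2) / 4)

lemma amp_sq (η : ℝ) : amp η ^ 2 = (1 + 3 * η ^ 2) / 4 := sq_sqrt (by positivity)

lemma amp_pos (η : ℝ) : 0 < amp η := sqrt_pos.2 (by positivity)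

lemma continuous_amp : Continuous amp := by
  unfold amp
  fun_prop

lemma amp_lt_one {η : ℝ} (hη : η ∈ Ioo (-1 : ℝ) 1) : amp η < 1 := by
  nlinarith [amp_sq η, amp_pos η, hη.1, hη.2]

lemma abs_lt_amp {η : ℝ} (hη : η ∈ Ioo (-1 : ℝ) 1) : |η| < amp η := by
  refine abs_lt_of_sq_lt_sq ?_ (amp_pos η).le
  nlinarith [amp_sq η, hη.1, hη.2]

/-- The angle at which the orbit starts. -/
noncomputable def startAngle (η : ℝ) : ℝ := arcsin (η / amp η)

lemma continuous_startAngle : Continuous startAngle :=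
  continuous_arcsin.comp (continuous_id.div continuous_amp fun η => (amp_pos η).ne')

lemma div_amp_mem {η : ℝ} (hη : η ∈ Ioo (-1 : ℝ) 1) : η / amp η ∈ Ioo (-1 : ℝ) 1 := by
  have h := abs_lt.1 (abs_lt_amp hη)
  have h0 := amp_pos η
  exact ⟨by rw [lt_div_iff₀ h0]; linarith, by rw [div_lt_iff₀ h0]; linarith⟩

lemma sin_startAngle {η : ℝ} (hη : η ∈ Ioo (-1 : ℝ) 1) : sin (startAngle η) = η / amp η :=
  sin_arcsin (div_amp_mem hη).1.le (div_amp_mem hη).2.le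

lemma amp_mul_sin_startAngle {η : ℝ} (hη : η ∈ Ioo (-1 : ℝ) 1) :
    amp η * sin (startAngle η) = η := by
  rw [sin_startAngle hη, mul_div_cancel₀ _ (amp_pos η).ne']

lemma startAngle_lt {η : ℝ} (hη : η ∈ Ioo (-1 : ℝ) 1) : startAngle η < π / 2 :=
  arcsin_lt_pi_div_two.2 (div_amp_mem hη).2

lemma neg_pi_div_two_le_startAngle (η : ℝ) : -(π / 2) ≤ startAngle η := neg_pi_div_two_le_arcsin _

lemma amp_mul_sin_mem {η : ℝ} (hη : η ∈ Ioo (-1 : ℝ) 1) (θ : ℝ) :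
    amp η * sin θ ∈ Ioo (-1 : ℝ) 1 := by
  have h0 := amp_pos η
  have h1 := amp_lt_one hη
  constructor <;> nlinarith [neg_one_le_sin θ, sin_le_one θ]

lemma continuous_kern_amp_mul_sin {η : ℝ} (hη : η ∈ Ioo (-1 : ℝ) 1) :
    Continuous fun θ => kern (amp η * sin θ) :=
  continuousOn_kern.comp_continuous (by fun_prop) (amp_mul_sin_mem hη)

/-- The period function in the coordinate `η`. -/
noncomputable def angleIntegral (η : ℝ) : ℝ :=
  ∫ θ in startAngle η..π / 2, kern (amp η * sin θ)

lemma strictMono_div_amp : StrictMono fun η => η / amp η := by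
  refine strictMono_of_deriv_pos fun η => ?_
  have h0 := amp_pos η
  have hd : HasDerivAt amp (3 * η / (4 * amp η)) η := by
    have h1 : HasDerivAt (fun η : ℝ => (1 + 3 * η ^ 2) / 4) (3 * η / 2) η :=
      ((((hasDerivAt_pow 2 η).const_mul 3).const_add 1).div_const 4).congr_deriv
        (by push_cast; ring)
    refine (h1.sqrt (by positivity)).congr_deriv ?_
    change 3 * η / 2 / (2 * amp η) = _
    field_simp
    norm_num
  have h2 : HasDerivAt (fun η => η / amp η) _ η := (hasDerivAt_id η).div hd h0.ne'
  rw [h2.deriv]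
  have h3 := amp_sq η
  have h4 : 1 * amp η - id η * (3 * η / (4 * amp η)) = 1 / (4 * amp η) := by
    simp only [id]
    field_simp
    linarith
  rw [h4]
  positivity

lemma startAngle_lt_startAngle {a b : ℝ} (ha : a ∈ Ioo (-1 : ℝ) 1) (hb : b ∈ Ioo (-1 : ℝ) 1)
    (hab : a < b) : startAngle a < startAngle b :=
  strictMonoOn_arcsin (Ioo_subset_Icc_self (div_amp_mem ha))
    (Ioo_subset_Icc_self (div_amp_mem hb)) (strictMono_div_amp hab)

lemma angleIntegral_sub {a b : ℝ} (ha : a ∈ Ioo (-1 : ℝ) 1) (hb : b ∈ Ioo (-1 : ℝ) 1) :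
    angleIntegral a - angleIntegral b =
      (∫ θ in startAngle a..startAngle b, kern (amp a * sin θ)) +
        ∫ θ in startAngle b..π / 2, (kern (amp a * sin θ) - kern (amp b * sin θ)) := by
  have hi : ∀ {c : ℝ}, c ∈ Ioo (-1 : ℝ) 1 → ∀ x y,
      IntervalIntegrable (fun θ => kern (amp c * sin θ)) volume x y :=
    fun hc => (continuous_kern_amp_mul_sin hc).intervalIntegrable
  rw [intervalIntegral.integral_sub (hi ha _ _) (hi hb _ _), ← add_sub_assoc,
    intervalIntegral.integral_add_adjacent_intervals (hi ha _ _) (hi ha _ _)]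
  rfl

lemma angleIntegral_lt_of_nonneg {a b : ℝ} (ha : 0 ≤ a) (hab : a < b) (hb : b < 1) :
    angleIntegral b < angleIntegral a := by
  have ha' : a ∈ Ioo (-1 : ℝ) 1 := ⟨by linarith, by linarith⟩
  have hb' : b ∈ Ioo (-1 : ℝ) 1 := ⟨by linarith, by linarith⟩
  have h1 : 0 < ∫ θ in startAngle a..startAngle b, kern (amp a * sin θ) :=
    intervalIntegral.intervalIntegral_pos_of_pos_on
      ((continuous_kern_amp_mul_sin ha').intervalIntegrable _ _) (fun _ _ => kern_pos _)
      (startAngle_lt_startAngle ha' hb' hab)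
  have h2 : 0 ≤ ∫ θ in startAngle b..π / 2, (kern (amp a * sin θ) - kern (amp b * sin θ)) := by
    refine intervalIntegral.integral_nonneg (startAngle_lt hb').le fun θ hθ => sub_nonneg.2 ?_
    have h3 : 0 ≤ startAngle b := arcsin_nonneg.2 (div_nonneg (ha.trans hab.le) (amp_pos b).le)
    have h4 : 0 ≤ sin θ := sin_nonneg_of_nonneg_of_le_pi (h3.trans hθ.1)
      (by linarith [hθ.2, pi_pos])
    refine antitoneOn_kern (amp_mul_sin_mem ha' θ) (amp_mul_sin_mem hb' θ) ?_
    refine mul_le_mul_of_nonneg_right (sqrt_le_sqrt ?_) h4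
    gcongr
  have h5 := angleIntegral_sub ha' hb'
  linarith

/-- The amplitude decreases more slowly than a third of the rate at which the starting sine
increases. -/
lemma amp_sub_amp_lt {a b : ℝ} (ha : -1 < a) (hab : a < b) (hb : b ≤ 0) :
    (amp a - amp b) / 3 < b / amp b - a / amp a := by
  have ha' : a ∈ Ioo (-1 : ℝ) 1 := ⟨by linarith, by linarith⟩
  have hb' : b ∈ Ioo (-1 : ℝ) 1 := ⟨by linarith, by linarith⟩
  have pa := amp_pos a
  have pb := amp_pos b
  have la := amp_lt_one ha'
  have lb := amp_lt_one hb'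
  have sa := amp_sq a
  have sb := amp_sq b
  have hd : 0 < a ^ 2 - b ^ 2 := by nlinarith
  have hpos : 0 < -a * amp b + -b * amp a := by nlinarith [mul_nonneg (neg_nonneg.2 hb) pa.le]
  have e1 : (amp a - amp b) / 3 = (a ^ 2 - b ^ 2) / (4 * (amp a + amp b)) := by
    field_simp
    linear_combination 4 * sa - 4 * sb
  have e2 : b / amp b - a / amp a =
      (a ^ 2 - b ^ 2) / (4 * (amp a * amp b * (-a * amp b + -b * amp a))) := by
    rw [div_sub_div _ _ pb.ne' pa.ne', div_eq_div_iff (by positivity) (by positivity)]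
    linear_combination (amp a * amp b) * (4 * a ^ 2 * sb - 4 * b ^ 2 * sa)
  rw [e1, e2]
  refine div_lt_div_of_pos_left hd (by positivity) ?_
  have h1 : -a * amp b + -b * amp a < amp b + amp a := by nlinarith
  have h2 : amp a * amp b < 1 := by nlinarith
  nlinarith

lemma angleIntegral_lt_of_nonpos {a b : ℝ} (ha : -1 < a) (hab : a < b) (hb : b ≤ 0) :
    angleIntegral b < angleIntegral a := by
  have ha' : a ∈ Ioo (-1 : ℝ) 1 := ⟨by linarith, by linarith⟩
  have hb' : b ∈ Ioo (-1 : ℝ) 1 := ⟨by linarith, by linarith⟩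
  have ca := continuous_kern_amp_mul_sin ha'
  have cb := continuous_kern_amp_mul_sin hb'
  have hθ := startAngle_lt_startAngle ha' hb' hab
  have hb0 : startAngle b ≤ 0 := arcsin_nonpos.2 (div_nonpos_of_nonpos_of_nonneg hb (amp_pos b).le)
  have hamp : amp b ≤ amp a := sqrt_le_sqrt (by nlinarith)
  have hsin : ∀ θ, startAngle a ≤ θ → θ ≤ 0 → sin θ ≤ 0 := fun θ h1 h2 =>
    sin_nonpos_of_nonpos_of_neg_pi_le h2 (by linarith [neg_pi_div_two_le_startAngle a, pi_pos])
  have h1 : kern 0 * (startAngle b - startAngle a) ≤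
      ∫ θ in startAngle a..startAngle b, kern (amp a * sin θ) := by
    have : ∫ _ in startAngle a..startAngle b, kern 0 =
        kern 0 * (startAngle b - startAngle a) := by
      simp [mul_comm]
    rw [← this]
    refine intervalIntegral.integral_mono_on hθ.le (by simp) (ca.intervalIntegrable _ _)
      fun θ h => antitoneOn_kern (amp_mul_sin_mem ha' θ) (by norm_num) ?_
    exact mul_nonpos_of_nonneg_of_nonpos (amp_pos a).le (hsin θ h.1 (h.2.trans hb0))
  have h2 : 0 ≤ ∫ θ in startAngle b..0, (kern (amp a * sin θ) - kern (amp b * sin θ)) := by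
    refine intervalIntegral.integral_nonneg hb0 fun θ h => sub_nonneg.2 ?_
    exact antitoneOn_kern (amp_mul_sin_mem ha' θ) (amp_mul_sin_mem hb' θ)
      (mul_le_mul_of_nonpos_right hamp (hsin θ (hθ.le.trans h.1) h.2))
  have h3 : -(kern 0 / 3 * (amp a - amp b)) ≤
      ∫ θ in (0 : ℝ)..π / 2, (kern (amp a * sin θ) - kern (amp b * sin θ)) := by
    have : ∫ θ in (0 : ℝ)..π / 2, -(kern 0 / 3 * (amp a - amp b)) * sin θ =
        -(kern 0 / 3 * (amp a - amp b)) := by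
      rw [intervalIntegral.integral_const_mul, integral_sin]
      simp
    rw [← this]
    refine intervalIntegral.integral_mono_on (by positivity)
      (Continuous.intervalIntegrable (by fun_prop) _ _) ((ca.sub cb).intervalIntegrable _ _)
      fun θ h => ?_
    have hs : 0 ≤ sin θ := sin_nonneg_of_nonneg_of_le_pi h.1 (by linarith [h.2, pi_pos])
    have := kern_sub_le (mul_nonneg (amp_pos b).le hs) (mul_le_mul_of_nonneg_right hamp hs)
      (amp_mul_sin_mem ha' θ).2
    linarith
  have h4 : b / amp b - a / amp a ≤ startAngle b - startAngle a := by
    rw [← sin_startAngle ha', ← sin_startAngle hb']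
    have := (le_abs_self _).trans (abs_sin_sub_sin_le (startAngle b) (startAngle a))
    rwa [abs_of_pos (sub_pos.2 hθ)] at this
  have h5 := intervalIntegral.integral_add_adjacent_intervals
    ((ca.sub cb).intervalIntegrable (μ := volume) (startAngle b) 0)
    ((ca.sub cb).intervalIntegrable 0 (π / 2))
  have h6 := angleIntegral_sub ha' hb'
  have h7 := mul_lt_mul_of_pos_left ((amp_sub_amp_lt ha hab hb).trans_le h4) (kern_pos 0)
  simp only [Pi.sub_apply] at h5
  rw [← h5] at h6
  linarith

lemma strictAntiOn_angleIntegral : StrictAntiOn angleIntegral (Ioo (-1) 1) := by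
  intro a ha b hb hab
  rcases le_or_gt 0 a with h | h
  · exact angleIntegral_lt_of_nonneg h hab hb.2
  rcases le_or_gt b 0 with h' | h'
  · exact angleIntegral_lt_of_nonpos ha.1 hab h'
  · exact (angleIntegral_lt_of_nonneg le_rfl h' hb.2).trans
      (angleIntegral_lt_of_nonpos ha.1 h le_rfl)

lemma continuousOn_angleIntegral : ContinuousOn angleIntegral (Ioo (-1) 1) := by
  intro η₀ h₀
  obtain ⟨c, hc₀, hc⟩ := exists_between (amp_lt_one h₀)
  have hmem : ∀ p : ℝ × ℝ, min (amp p.1) c * sin p.2 ∈ Ioo (-1 : ℝ) 1 := by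
    intro p
    have h1 : 0 < min (amp p.1) c := lt_min (amp_pos _) ((amp_pos _).trans hc₀)
    have h2 : min (amp p.1) c < 1 := (min_le_right _ _).trans_lt hc
    constructor <;> nlinarith [neg_one_le_sin p.2, sin_le_one p.2]
  have hcont : Continuous (Function.uncurry fun η θ => kern (min (amp η) c * sin θ)) := by
    have := continuous_amp
    exact continuousOn_kern.comp_continuous (by fun_prop) hmem
  have h := intervalIntegral.continuous_parametric_intervalIntegral_of_continuous
    (μ := volume) (a₀ := π / 2) hcont continuous_startAngle
  refine (h.neg.continuousAt.congr ?_).continuousWithinAt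
  filter_upwards [continuous_amp.continuousAt.eventually_lt continuousAt_const hc₀] with η hη
  simp only [Pi.neg_apply, min_eq_left hη.le]
  exact (intervalIntegral.integral_symm _ _).symm

lemma exists_angleIntegral_lt {ℓ : ℝ} (hℓ : 0 < ℓ) : ∃ η ∈ Ioo (-1 : ℝ) 1, angleIntegral η < ℓ := by
  have hlim : Tendsto (fun η => kern 0 * (π / 2 - startAngle η)) (𝓝[<] 1) (𝓝 0) := by
    have h1 : Continuous fun η => kern 0 * (π / 2 - startAngle η) := by
      have := continuous_startAngle
      fun_prop
    have h2 : startAngle 1 = π / 2 := by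
      simp [startAngle, amp, show ((1 : ℝ) + 3) / 4 = 1 by norm_num]
    have h3 := h1.tendsto 1
    rw [h2, sub_self, mul_zero] at h3
    exact h3.mono_left nhdsWithin_le_nhds
  obtain ⟨η, hη, h0⟩ := ((hlim.eventually_lt_const hℓ).and
    (Ioo_mem_nhdsLT (zero_lt_one' ℝ))).exists
  have hm : η ∈ Ioo (-1 : ℝ) 1 := ⟨by linarith [h0.1], h0.2⟩
  refine ⟨η, hm, lt_of_le_of_lt ?_ hη⟩
  have : ∫ _ in startAngle η..π / 2, kern 0 = kern 0 * (π / 2 - startAngle η) := by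
    simp [mul_comm]
  rw [← this]
  refine intervalIntegral.integral_mono_on (startAngle_lt hm).le
    ((continuous_kern_amp_mul_sin hm).intervalIntegrable _ _) (by simp) fun θ h => ?_
  refine antitoneOn_kern (by norm_num) (amp_mul_sin_mem hm θ) (mul_nonneg (amp_pos η).le ?_)
  exact sin_nonneg_of_nonneg_of_le_pi
    ((arcsin_nonneg.2 (div_nonneg h0.1.le (amp_pos η).le)).trans h.1) (by linarith [h.2, pi_pos])

lemma sqrt_one_sub_sub_one_le_angleIntegral {w : ℝ} (hw : w < 0) :
    √(1 - w) - 1 ≤ angleIntegral (potCoord w) := by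
  have hm : potCoord w ∈ Ioo (-1 : ℝ) 1 := ⟨neg_one_lt_potCoord w, potCoord_lt_one (by linarith)⟩
  set η := potCoord w with hη
  have hη0 : η < 0 := potCoord_neg hw
  have cη := continuous_kern_amp_mul_sin hm
  have hs0 : startAngle η ≤ 0 :=
    arcsin_nonpos.2 (div_nonpos_of_nonpos_of_nonneg hη0.le (amp_pos η).le)
  have hder : ∀ θ, HasDerivAt (fun θ => -√(1 - invCoord (amp η * sin θ)))
      (kern (amp η * sin θ) * (amp η * cos θ) / (exp (invCoord (amp η * sin θ) / 2) *
        √(1 - invCoord (amp η * sin θ)))) θ := by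
    intro θ
    have hmθ := amp_mul_sin_mem hm θ
    have hpos := sub_pos.2 (invCoord_lt_one hmθ)
    have h1 : HasDerivAt (fun θ => invCoord (amp η * sin θ)) _ θ :=
      (hasDerivAt_invCoord hmθ).comp θ ((hasDerivAt_sin θ).const_mul (amp η))
    refine ((h1.const_sub 1).sqrt hpos.ne').neg.congr_deriv ?_
    have := sqrt_pos.2 hpos
    unfold kern
    field_simp
  have h1 := intervalIntegral.sub_le_integral_of_hasDeriv_right_of_le hs0
    (fun θ _ => (hder θ).continuousAt.continuousWithinAt)
    (fun θ _ => (hder θ).hasDerivWithinAt)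
    (cη.integrableOn_Icc) (fun θ _ => ?_)
  · rw [amp_mul_sin_startAngle hm, sin_zero, mul_zero, invCoord_zero, sub_zero, sqrt_one, hη,
      invCoord_potCoord, ← hη] at h1
    have h2 : 0 ≤ ∫ θ in (0 : ℝ)..π / 2, kern (amp η * sin θ) :=
      intervalIntegral.integral_nonneg (by positivity) fun _ _ => (kern_pos _).le
    have h3 := intervalIntegral.integral_add_adjacent_intervals
      (cη.intervalIntegrable (μ := volume) (startAngle η) 0) (cη.intervalIntegrable 0 (π / 2))
    rw [angleIntegral]
    linarith
  · have hmθ := amp_mul_sin_mem hm θ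
    have hpos := sub_pos.2 (invCoord_lt_one hmθ)
    have h4 := potCoord_sq (invCoord (amp η * sin θ))
    rw [potCoord_invCoord hmθ] at h4
    set v := invCoord (amp η * sin θ)
    have h5 : exp (v / 2) ^ 2 = exp v := by rw [← exp_nat_mul]; ring_nf
    rw [div_le_iff₀ (mul_pos (exp_pos _) (sqrt_pos.2 hpos))]
    refine mul_le_mul_of_nonneg_left (abs_le_of_sq_le_sq' ?_ (by positivity)).2 (kern_pos _).le
    rw [mul_pow, mul_pow, h5, sq_sqrt hpos.le, cos_sq']
    nlinarith [amp_lt_one hm, amp_pos η]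

lemma exists_lt_angleIntegral (ℓ : ℝ) : ∃ η ∈ Ioo (-1 : ℝ) 1, ℓ < angleIntegral η := by
  have hw : -(ℓ + 2) ^ 2 - 1 < 0 := by nlinarith [sq_nonneg (ℓ + 2)]
  refine ⟨potCoord (-(ℓ + 2) ^ 2 - 1), ⟨neg_one_lt_potCoord _, potCoord_lt_one (by linarith)⟩, ?_⟩
  have h1 := sqrt_one_sub_sub_one_le_angleIntegral hw
  have h2 : ℓ + 2 ≤ √(1 - (-(ℓ + 2) ^ 2 - 1)) := le_sqrt_of_sq_le (by linarith)
  linarith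

lemma exists_angleIntegral_eq {ℓ : ℝ} (hℓ : 0 < ℓ) :
    ∃ η ∈ Ioo (-1 : ℝ) 1, angleIntegral η = ℓ := by
  obtain ⟨a, ha, ha'⟩ := exists_angleIntegral_lt hℓ
  obtain ⟨b, hb, hb'⟩ := exists_lt_angleIntegral ℓ
  exact isPreconnected_Ioo.intermediate_value ha hb continuousOn_angleIntegral
    ⟨ha'.le, hb'.le⟩

/-- The change of variables `u = exp ((w + 1) / 2)`, `potCoord w = R sin θ`. -/
lemma integral_inv_sqrt_eq_angleIntegral {A : ℝ → ℝ}
    (hA : ∀ u, A u = 2 * u ^ 2 - u ^ 2 * log (u ^ 2)) {r s : ℝ}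
    (hr : r ∈ Ioo 0 (exp 1)) (hs : s ∈ Ioo √(exp 1) (exp 1)) (hrs : A s = 3 / 4 * A r) :
    ∫ φ in r..s, (√(A φ - 3 / 4 * A r))⁻¹ = angleIntegral (potCoord (2 * log r - 1)) := by
  have hAexp : ∀ w, A (exp ((w + 1) / 2)) = exp 1 * (1 - potCoord w ^ 2) := by
    intro w
    have h1 : exp ((w + 1) / 2) ^ 2 = exp 1 * exp w := by
      rw [← exp_nat_mul, ← exp_add]
      ring_nf
    rw [hA, h1, ← exp_add, log_exp, exp_add, potCoord_sq]
    ring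
  have hexp : ∀ {u : ℝ}, 0 < u → exp ((2 * log u - 1 + 1) / 2) = u := fun {u} hu => by
    rw [show (2 * log u - 1 + 1) / 2 = log u by ring, exp_log hu]
  have hs0 : 0 < s := (sqrt_pos.2 (exp_pos 1)).trans hs.1
  have hm : potCoord (2 * log r - 1) ∈ Ioo (-1 : ℝ) 1 := by
    refine ⟨neg_one_lt_potCoord _, potCoord_lt_one ?_⟩
    have := (log_lt_iff_lt_exp hr.1).2 hr.2
    linarith
  set η := potCoord (2 * log r - 1) with hη
  have hAr : A r = exp 1 * (1 - η ^ 2) := by rw [hη, ← hAexp, hexp hr.1]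
  have hamp : potCoord (2 * log s - 1) = amp η := by
    have h1 : A s = exp 1 * (1 - potCoord (2 * log s - 1) ^ 2) := by rw [← hAexp, hexp hs0]
    have h2 : 0 < 2 * log s - 1 := by
      have := log_lt_log (sqrt_pos.2 (exp_pos 1)) hs.1
      rw [log_sqrt (exp_pos 1).le, log_exp] at this
      linarith
    have h3 : exp 1 * (potCoord (2 * log s - 1) ^ 2 - amp η ^ 2) = 0 := by
      rw [amp_sq]
      linear_combination h1 - hrs - 3 / 4 * hAr
    have h4 := (mul_eq_zero.1 h3).resolve_left (exp_pos 1).ne'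
    exact (pow_left_inj₀ (potCoord_pos h2).le (amp_pos η).le two_ne_zero).1 (by linarith)
  set U : ℝ → ℝ := fun θ => exp ((invCoord (amp η * sin θ) + 1) / 2) with hU
  have hUr : U (startAngle η) = r := by
    simp only [hU]
    rw [amp_mul_sin_startAngle hm, hη, invCoord_potCoord, hexp hr.1]
  have hUs : U (π / 2) = s := by
    simp only [hU]
    rw [sin_pi_div_two, mul_one, ← hamp, invCoord_potCoord, hexp hs0]
  have hlt := startAngle_lt hm
  have hder : ∀ θ, HasDerivAt U (√(exp 1) * kern (amp η * sin θ) * (amp η * cos θ)) θ := by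
    intro θ
    have h1 : HasDerivAt (fun θ => invCoord (amp η * sin θ)) _ θ :=
      (hasDerivAt_invCoord (amp_mul_sin_mem hm θ)).comp θ ((hasDerivAt_sin θ).const_mul (amp η))
    refine ((h1.add_const 1).div_const 2).exp.congr_deriv ?_
    rw [add_div, exp_add, ← exp_half]
    unfold kern
    field_simp
  have hUmono : StrictMonoOn U (Icc (startAngle η) (π / 2)) := by
    intro x hx y hy hxy
    have h1 : sin x < sin y := strictMonoOn_sin
      ⟨(neg_pi_div_two_le_startAngle η).trans hx.1, hx.2⟩
      ⟨(neg_pi_div_two_le_startAngle η).trans hy.1, hy.2⟩ hxy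
    have h2 := strictMonoOn_invCoord (amp_mul_sin_mem hm x) (amp_mul_sin_mem hm y)
      (mul_lt_mul_of_pos_left h1 (amp_pos η))
    exact exp_lt_exp.2 (by linarith)
  have himg : U '' Ioo (startAngle η) (π / 2) = Ioo r s := by
    rw [← hUr, ← hUs]
    refine Subset.antisymm ?_ (intermediate_value_Ioo hlt.le
      fun θ _ => (hder θ).continuousAt.continuousWithinAt)
    rintro _ ⟨θ, hθ, rfl⟩
    exact ⟨hUmono (left_mem_Icc.2 hlt.le) (Ioo_subset_Icc_self hθ) hθ.1,
      hUmono (Ioo_subset_Icc_self hθ) (right_mem_Icc.2 hlt.le) hθ.2⟩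
  have hrs' : r ≤ s := by
    rw [← hUr, ← hUs]
    exact hUmono.monotoneOn (left_mem_Icc.2 hlt.le) (right_mem_Icc.2 hlt.le) hlt.le
  rw [angleIntegral, intervalIntegral.integral_of_le hrs', intervalIntegral.integral_of_le hlt.le,
    integral_Ioc_eq_integral_Ioo, integral_Ioc_eq_integral_Ioo, ← himg,
    integral_image_eq_integral_deriv_smul_of_monotoneOn measurableSet_Ioo
      (fun θ _ => (hder θ).hasDerivWithinAt) (hUmono.monotoneOn.mono Ioo_subset_Icc_self)]
  refine setIntegral_congr_fun measurableSet_Ioo fun θ hθ => ?_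
  have hcos : 0 < amp η * cos θ := mul_pos (amp_pos η)
    (cos_pos_of_mem_Ioo ⟨(neg_pi_div_two_le_startAngle η).trans_lt hθ.1, hθ.2⟩)
  have hval : A (U θ) - 3 / 4 * A r = exp 1 * (amp η * cos θ) ^ 2 := by
    rw [hAr]
    simp only [hU]
    rw [hAexp, potCoord_invCoord (amp_mul_sin_mem hm θ), mul_pow, mul_pow, cos_sq', amp_sq]
    ring
  simp only [smul_eq_mul]
  rw [hval, sqrt_mul (exp_pos 1).le, sqrt_sq hcos.le, mul_right_comm √(exp 1),
    mul_right_comm, mul_inv_cancel₀ (by positivity), one_mul]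

/-- For every `ℓ > 0` there is a unique `r₀ ∈ (0, e)` with `T r₀ = ℓ`,
where `T r₀ = ∫_{r₀}^{r₊(r₀)} (A φ - (3/4) A r₀)^{-1/2} dφ` is the period function. -/
theorem period_function_bijective (A : ℝ → ℝ)
    (hA : ∀ u, A u = 2 * u ^ 2 - u ^ 2 * Real.log (u ^ 2))
    (rp : ℝ → ℝ)
    (hrp : ∀ r₀ ∈ Set.Ioo (0 : ℝ) (Real.exp 1),
      rp r₀ ∈ Set.Ioo (Real.sqrt (Real.exp 1)) (Real.exp 1) ∧
        A (rp r₀) = 3 / 4 * A r₀)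
    (T : ℝ → ℝ)
    (hT : ∀ r₀ ∈ Set.Ioo (0 : ℝ) (Real.exp 1),
      T r₀ = ∫ φ in r₀..(rp r₀), (Real.sqrt (A φ - 3 / 4 * A r₀))⁻¹) :
    ∀ ℓ : ℝ, 0 < ℓ →
      ∃! r₀ : ℝ, r₀ ∈ Set.Ioo (0 : ℝ) (Real.exp 1) ∧ T r₀ = ℓ := by
  intro ℓ hℓ
  have hTη : ∀ r ∈ Ioo 0 (exp 1), T r = angleIntegral (potCoord (2 * log r - 1)) := fun r hr => by
    rw [hT r hr, integral_inv_sqrt_eq_angleIntegral hA hr (hrp r hr).1 (hrp r hr).2]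
  have hmem : ∀ r ∈ Ioo 0 (exp 1), potCoord (2 * log r - 1) ∈ Ioo (-1 : ℝ) 1 := fun r hr =>
    ⟨neg_one_lt_potCoord _,
      potCoord_lt_one (by linarith [(log_lt_iff_lt_exp hr.1).2 hr.2])⟩
  obtain ⟨η, hη, rfl⟩ := exists_angleIntegral_eq hℓ
  have hr : exp ((invCoord η + 1) / 2) ∈ Ioo 0 (exp 1) :=
    ⟨exp_pos _, exp_lt_exp.2 (by linarith [invCoord_lt_one hη])⟩
  have hηr : potCoord (2 * log (exp ((invCoord η + 1) / 2)) - 1) = η := by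
    rw [log_exp, show 2 * ((invCoord η + 1) / 2) - 1 = invCoord η by ring, potCoord_invCoord hη]
  refine ⟨_, ⟨hr, by rw [hTη _ hr, hηr]⟩, ?_⟩
  rintro r ⟨hr', h⟩
  rw [hTη r hr'] at h
  have h1 := strictAntiOn_angleIntegral.injOn (hmem r hr') hη h
  have h2 := strictMono_potCoord.injective (h1.trans hηr.symm)
  exact log_injOn_pos hr'.1 hr.1 (by linarith)
end

section
/- Let μ > 0 and γ ∈ ℝ with γ + 2√μ > 0. Then for all x, y ∈ ℝ, K(x, y) = (1/(2√μ))·[e^{−√μ·|x−y|} − (γ/(γ + 2√μ))·e^{−√μ·(|x|+|y|)}] > 0. -/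
/-- Positivity of the Krein resolvent kernel of the δ-interaction Laplacian:
for `μ > 0` and `γ + 2√μ > 0`,
`K(x,y) = (1/(2√μ))(e^{-√μ|x-y|} - (γ/(γ+2√μ)) e^{-√μ(|x|+|y|)}) > 0` for all `x, y`. -/
theorem krein_kernel_pos (μ γ : ℝ) (hμ : 0 < μ) (hγ : 0 < γ + 2 * Real.sqrt μ) :
    ∀ x y : ℝ,
      0 < (1 / (2 * Real.sqrt μ)) *
        (Real.exp (-Real.sqrt μ * |x - y|) -
          (γ / (γ + 2 * Real.sqrt μ)) * Real.exp (-Real.sqrt μ * (|x| + |y|))) := by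
  intro x y
  have hs : 0 < Real.sqrt μ := Real.sqrt_pos.2 hμ
  have hc : γ / (γ + 2 * Real.sqrt μ) < 1 := (div_lt_one hγ).2 (by linarith)
  refine mul_pos (by positivity) (sub_pos.2 ?_)
  calc γ / (γ + 2 * Real.sqrt μ) * Real.exp (-Real.sqrt μ * (|x| + |y|))
      < Real.exp (-Real.sqrt μ * (|x| + |y|)) := mul_lt_of_lt_one_left (Real.exp_pos _) hc
    _ ≤ Real.exp (-Real.sqrt μ * |x - y|) :=
      Real.exp_le_exp.2 (mul_le_mul_of_nonpos_left (abs_sub x y) (by linarith))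
end

section
/- Let c ∈ ℝ, let a < b be real numbers, and let φ : [a, b] → ℝ be twice continuously differentiable with φ(x) > 0 and φ''(x) = c·φ(x) − φ(x)·log(φ(x)²) for all x ∈ [a, b]. Then for every twice continuously differentiable f : [a, b] → ℝ with f(a) = f(b) = 0, ∫_a^b (−f''(x) + c·f(x) − f(x)·log(φ(x)²))·f(x) dx = ∫_a^b φ(x)²·((f/φ)'(x))² dx; in particular this quantity is nonnegative. -/
/-- Quadratic-form identity for the linearization around a positive solution
`φ` of `φ'' = c φ - φ log(φ²)` on `[a, b]`: for every C² function `f` vanishing at `a` and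
`b`, `∫_a^b (-f'' + c f - f log(φ²)) f = ∫_a^b φ² ((f/φ)')² ≥ 0`. -/
theorem quadratic_form_identity (c a b : ℝ) (hab : a < b)
    (φ φ' φ'' f f' f'' : ℝ → ℝ)
    (hφ1 : ∀ x ∈ Set.Icc a b, HasDerivAt φ (φ' x) x)
    (hφ2 : ∀ x ∈ Set.Icc a b, HasDerivAt φ' (φ'' x) x)
    (hφc : ContinuousOn φ'' (Set.Icc a b))
    (hφpos : ∀ x ∈ Set.Icc a b, 0 < φ x)
    (hode : ∀ x ∈ Set.Icc a b, φ'' x = c * φ x - φ x * Real.log (φ x ^ 2))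
    (hf1 : ∀ x ∈ Set.Icc a b, HasDerivAt f (f' x) x)
    (hf2 : ∀ x ∈ Set.Icc a b, HasDerivAt f' (f'' x) x)
    (hfc : ContinuousOn f'' (Set.Icc a b))
    (hfa : f a = 0) (hfb : f b = 0) :
    (∫ x in a..b, (-f'' x + c * f x - f x * Real.log (φ x ^ 2)) * f x) =
      (∫ x in a..b, φ x ^ 2 * (deriv (fun y => f y / φ y) x) ^ 2) ∧
    0 ≤ ∫ x in a..b, (-f'' x + c * f x - f x * Real.log (φ x ^ 2)) * f x := by
  have hne : ∀ x ∈ Set.Icc a b, φ x ≠ 0 := fun x hx => (hφpos x hx).ne'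
  have cφ : ContinuousOn φ (Set.Icc a b) := fun x hx => (hφ1 x hx).continuousAt.continuousWithinAt
  have cφ' : ContinuousOn φ' (Set.Icc a b) := fun x hx => (hφ2 x hx).continuousAt.continuousWithinAt
  have cf : ContinuousOn f (Set.Icc a b) := fun x hx => (hf1 x hx).continuousAt.continuousWithinAt
  have cf' : ContinuousOn f' (Set.Icc a b) := fun x hx => (hf2 x hx).continuousAt.continuousWithinAt
  have hL : ContinuousOn (fun x => (-f'' x + c * f x - f x * Real.log (φ x ^ 2)) * f x)
      (Set.Icc a b) :=
    ((hfc.neg.add (continuousOn_const.mul cf)).sub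
      (cf.mul ((cφ.pow 2).log fun x hx => pow_ne_zero 2 (hne x hx)))).mul cf
  have hR : ContinuousOn (fun x => φ x ^ 2 * (deriv (fun y => f y / φ y) x) ^ 2)
      (Set.Icc a b) := by
    refine ((cφ.pow 2).mul ((((cf'.mul cφ).sub (cf.mul cφ')).div (cφ.pow 2)
      fun x hx => pow_ne_zero 2 (hne x hx)).pow 2)).congr fun x hx => ?_
    simp only [((hf1 x hx).fun_div (hφ1 x hx) (hne x hx)).deriv, Pi.mul_apply, Pi.pow_apply,
      Pi.sub_apply, Pi.div_apply]
  have iL := hL.intervalIntegrable_of_Icc (μ := MeasureTheory.volume) hab.le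
  have iR := hR.intervalIntegrable_of_Icc (μ := MeasureTheory.volume) hab.le
  -- The integrands differ by the derivative of `(φ' / φ) f² - f' f`, which vanishes at `a`, `b`.
  have key : ∀ x ∈ Set.uIcc a b, HasDerivAt (fun y => φ' y / φ y * f y ^ 2 - f' y * f y)
      ((-f'' x + c * f x - f x * Real.log (φ x ^ 2)) * f x -
        φ x ^ 2 * (deriv (fun y => f y / φ y) x) ^ 2) x := by
    intro x hx
    rw [Set.uIcc_of_le hab.le] at hx
    have h0 := hne x hx
    rw [((hf1 x hx).fun_div (hφ1 x hx) h0).deriv]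
    refine ((((hφ2 x hx).fun_div (hφ1 x hx) h0).fun_mul ((hf1 x hx).fun_pow 2)).fun_sub
      ((hf2 x hx).fun_mul (hf1 x hx))).congr_deriv ?_
    rw [hode x hx]
    field_simp
    ring
  have hint := intervalIntegral.integral_eq_sub_of_hasDerivAt key (iL.sub iR)
  rw [intervalIntegral.integral_sub iL iR] at hint
  simp only [hfa, hfb] at hint
  have heq : (∫ x in a..b, (-f'' x + c * f x - f x * Real.log (φ x ^ 2)) * f x) =
      ∫ x in a..b, φ x ^ 2 * (deriv (fun y => f y / φ y) x) ^ 2 := by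
    linarith
  refine ⟨heq, ?_⟩
  rw [heq]
  exact intervalIntegral.integral_nonneg hab.le fun x _ => by positivity
end
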